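/- For |q|<1, q²·ψ²(q)·ψ²(q⁷) = (1/3)·∑_{j≥1} ( jq^j/(1−q^j) − jq^{2j}/(1−q^{2j}) − 7jq^{7j}/(1−q^{7j}) + 7jq^{14j}/(1−q^{14j}) ) − (1/3)·η₁η₂η₇η₁₄, where η_m = q^{m/24}∏_{n≥1}(1−q^{mn}). -/

import Mathlib

noncomputable section

section Auxiliary

open Filter Topology

/-- The partial product `∏_{k=1}^{n} (1 - q^k)`. -/
def eulerProd (q : ℂ) (n : ℕ) : ℂ := ∏ k ∈ Finset.range n, (1 - q ^ (k + 1))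

lemma one_sub_pow_ne_zero {q : ℂ} (hq : ‖q‖ < 1) (n : ℕ) : 1 - q ^ (n + 1) ≠ 0 := by
  intro h
  have h1 : ‖q ^ (n + 1)‖ < 1 := by
    rw [norm_pow]; exact pow_lt_one₀ (norm_nonneg _) hq (by omega)
  rw [← sub_eq_zero.mp h] at h1
  simp at h1

lemma one_add_pow_ne_zero {q : ℂ} (hq : ‖q‖ < 1) (n : ℕ) : 1 + q ^ n ≠ 0 := by
  rcases n with _ | n
  · norm_num
  · have h := one_sub_pow_ne_zero (q := q ^ (n + 1)) (by
      rw [norm_pow]; exact pow_lt_one₀ (norm_nonneg _) hq (by omega)) 1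
    intro h'
    apply h
    linear_combination (1 - q ^ (n + 1)) * h'

lemma norm_pow_lt_one {q : ℂ} (hq : ‖q‖ < 1) {n : ℕ} (hn : n ≠ 0) : ‖q ^ n‖ < 1 := by
  rw [norm_pow]; exact pow_lt_one₀ (norm_nonneg _) hq hn

lemma eulerProd_zero (q : ℂ) : eulerProd q 0 = 1 := by simp [eulerProd]

lemma eulerProd_succ (q : ℂ) (n : ℕ) :
    eulerProd q (n + 1) = eulerProd q n * (1 - q ^ (n + 1)) := by
  simp [eulerProd, Finset.prod_range_succ]

lemma eulerProd_ne_zero {q : ℂ} (hq : ‖q‖ < 1) (n : ℕ) : eulerProd q n ≠ 0 :=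
  Finset.prod_ne_zero_iff.mpr fun _ _ ↦ one_sub_pow_ne_zero hq _

lemma tendsto_eulerProd {q : ℂ} (hq : ‖q‖ < 1) :
    Tendsto (eulerProd q) atTop (𝓝 (∏' n, (1 - q ^ (n + 1)))) :=
  (ModularForm.multipliable_one_sub_pow hq).hasProd.tendsto_prod_nat

lemma tprod_one_sub_pow_ne_zero {q : ℂ} (hq : ‖q‖ < 1) : ∏' n : ℕ, (1 - q ^ (n + 1)) ≠ 0 := by
  have h := tprod_one_add_ne_zero_of_summable (R := ℂ) (f := fun n : ℕ ↦ -q ^ (n + 1))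
    (fun i ↦ by simpa [← sub_eq_add_neg] using one_sub_pow_ne_zero hq i)
    (by simpa using (summable_nat_add_iff 1).mpr (summable_geometric_of_lt_one (norm_nonneg _) hq))
  simpa [← sub_eq_add_neg] using h

/-- A sequence of nonzero numbers with a nonzero limit has uniformly bounded quotients. -/
lemma exists_norm_div_le {u : ℕ → ℂ} {a : ℂ} (hu : Tendsto u atTop (𝓝 a)) (ha : a ≠ 0) :
    ∃ C, ∀ m n, ‖u m / u n‖ ≤ C := by
  obtain ⟨A, hA⟩ := (isBounded_iff_forall_norm_le.mp (Metric.isBounded_range_of_tendsto u hu))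
  obtain ⟨B, hB⟩ := (isBounded_iff_forall_norm_le.mp
    (Metric.isBounded_range_of_tendsto _ (hu.inv₀ ha)))
  refine ⟨A * B, fun m n ↦ ?_⟩
  rw [div_eq_mul_inv, norm_mul]
  exact mul_le_mul (hA _ ⟨m, rfl⟩) (hB _ ⟨n, rfl⟩) (norm_nonneg _)
    ((norm_nonneg _).trans (hA _ ⟨m, rfl⟩))

lemma tendsto_sum_range_zero {r C : ℝ} (hr0 : 0 ≤ r) (hr : r < 1) {f : ℕ → ℕ → ℂ}
    (hf : ∀ n s, ‖f n s‖ ≤ C * r ^ n) :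
    Tendsto (fun n ↦ ∑ s ∈ Finset.range n, f n s) atTop (𝓝 0) := by
  have h := (tendsto_self_mul_const_pow_of_lt_one hr0 hr).const_mul C
  rw [mul_zero] at h
  refine squeeze_zero_norm (fun n ↦ ?_) h
  refine (norm_sum_le _ _).trans ((Finset.sum_le_sum fun s _ ↦ hf n s).trans ?_)
  simp only [Finset.sum_const, Finset.card_range, nsmul_eq_mul]
  exact le_of_eq (by ring)

section Gauss

variable {q : ℂ}

/-- The partial product of `∏ (1 - q^k) / (1 + q^k)`. -/
def phiProd (q : ℂ) (n : ℕ) : ℂ := eulerProd q n ^ 2 / eulerProd (q ^ 2) n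

lemma phiProd_succ (hq : ‖q‖ < 1) (n : ℕ) :
    phiProd q (n + 1) = phiProd q n * ((1 - q ^ (n + 1)) / (1 + q ^ (n + 1))) := by
  have h1 := one_sub_pow_ne_zero hq n
  have h2 := one_add_pow_ne_zero hq (n + 1)
  have h3 := eulerProd_ne_zero (norm_pow_lt_one hq two_ne_zero) n
  have h4 : (1 - (q ^ 2) ^ (n + 1)) = (1 - q ^ (n + 1)) * (1 + q ^ (n + 1)) := by ring
  rw [phiProd, phiProd, eulerProd_succ, eulerProd_succ, h4]
  field_simp

lemma phiProd_ne_zero (hq : ‖q‖ < 1) (n : ℕ) : phiProd q n ≠ 0 :=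
  div_ne_zero (pow_ne_zero _ (eulerProd_ne_zero hq n))
    (eulerProd_ne_zero (norm_pow_lt_one hq two_ne_zero) n)

lemma tendsto_phiProd (hq : ‖q‖ < 1) :
    Tendsto (phiProd q) atTop
      (𝓝 ((∏' n : ℕ, (1 - q ^ (n + 1))) ^ 2 / ∏' n : ℕ, (1 - (q ^ 2) ^ (n + 1)))) :=
  have h2 := norm_pow_lt_one hq two_ne_zero
  ((tendsto_eulerProd hq).pow 2).div (tendsto_eulerProd h2) (tprod_one_sub_pow_ne_zero h2)

lemma phi_telescope (hq : ‖q‖ < 1) (n m : ℕ) :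
    ∑ s ∈ Finset.range m,
      ((-1) ^ s * (phiProd q (n + 1) / phiProd q s) * q ^ (s * (n + 2)) * (2 / (1 + q ^ s)) -
        (-1) ^ s * (phiProd q n / phiProd q s) * q ^ (s * (n + 1)) * (2 / (1 + q ^ s))) =
      2 * (-1) ^ m * (phiProd q n / phiProd q m) * ((1 - q ^ m) / (1 + q ^ m)) *
        q ^ (m * (n + 1)) / (1 + q ^ (n + 1)) := by
  induction m with
  | zero => simp
  | succ m ih =>
    have h1 := one_sub_pow_ne_zero hq m
    have h2 := one_add_pow_ne_zero hq (m + 1)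
    have h3 := one_add_pow_ne_zero hq m
    have h4 := one_add_pow_ne_zero hq (n + 1)
    have h5 := phiProd_ne_zero hq m
    rw [Finset.sum_range_succ, ih, phiProd_succ hq m, phiProd_succ hq n]
    have e1 : q ^ (m * (n + 2)) = q ^ (m * (n + 1)) * q ^ m := by ring
    have e2 : q ^ ((m + 1) * (n + 1)) = q ^ (m * (n + 1)) * q ^ (n + 1) := by ring
    rw [e1, e2]
    generalize q ^ (m * (n + 1)) = X at *
    generalize q ^ (n + 1) = Y at *
    generalize q ^ (m + 1) = Z at *
    generalize q ^ m = W at *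
    field_simp
    ring

lemma phi_finite (hq : ‖q‖ < 1) (n : ℕ) :
    1 + 2 * ∑ k ∈ Finset.range n, (-1) ^ (k + 1) * q ^ ((k + 1) ^ 2) =
      ∑ s ∈ Finset.range (n + 1),
        (-1) ^ s * (phiProd q n / phiProd q s) * q ^ (s * (n + 1)) * (2 / (1 + q ^ s)) := by
  induction n with
  | zero =>
    have := phiProd_ne_zero hq 0
    norm_num [this]
  | succ n ih =>
    have h := phi_telescope hq n (n + 1)
    rw [Finset.sum_sub_distrib, ← ih] at h
    rw [Finset.sum_range_succ _ (n + 1), Finset.sum_range_succ _ n]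
    have e : (n + 1 + 1) = n + 2 := rfl
    rw [e, eq_add_of_sub_eq h, div_self (phiProd_ne_zero hq (n + 1)), phiProd_succ hq n]
    have h1 := one_sub_pow_ne_zero hq n
    have h4 := one_add_pow_ne_zero hq (n + 1)
    have h5 := phiProd_ne_zero hq n
    have e1 : q ^ ((n + 1) * (n + 2)) = q ^ ((n + 1) ^ 2) * q ^ (n + 1) := by ring
    have e2 : q ^ ((n + 1) * (n + 1)) = q ^ ((n + 1) ^ 2) := by ring
    rw [e1, e2]
    generalize q ^ ((n + 1) ^ 2) = X at *
    generalize q ^ (n + 1) = Y at *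
    field_simp
    ring

/-- Gauss's identity `φ(-q) = ∏ (1 - q^n)² / (1 - q^{2n})`. -/
theorem gauss_phi (hq : ‖q‖ < 1) :
    Tendsto (fun n ↦ 1 + 2 * ∑ k ∈ Finset.range n, (-1) ^ (k + 1) * q ^ ((k + 1) ^ 2)) atTop
      (𝓝 ((∏' n : ℕ, (1 - q ^ (n + 1))) ^ 2 / ∏' n : ℕ, (1 - (q ^ 2) ^ (n + 1)))) := by
  have h2 := norm_pow_lt_one hq two_ne_zero
  obtain ⟨C, hC⟩ := exists_norm_div_le (tendsto_phiProd hq)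
    (div_ne_zero (pow_ne_zero _ (tprod_one_sub_pow_ne_zero hq)) (tprod_one_sub_pow_ne_zero h2))
  have hr : 0 < 1 - ‖q‖ := by linarith
  have htail := tendsto_sum_range_zero (r := ‖q‖) (C := C * (2 / (1 - ‖q‖))) (norm_nonneg q) hq
    (f := fun n s ↦ (-1) ^ (s + 1) * (phiProd q n / phiProd q (s + 1)) *
      q ^ ((s + 1) * (n + 1)) * (2 / (1 + q ^ (s + 1)))) fun n s ↦ by
    have hden : 1 - ‖q‖ ≤ ‖1 + q ^ (s + 1)‖ := by
      have h := norm_sub_le (1 + q ^ (s + 1)) (q ^ (s + 1))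
      rw [add_sub_cancel_right, norm_one, norm_pow] at h
      have : ‖q‖ ^ (s + 1) ≤ ‖q‖ := pow_le_of_le_one (norm_nonneg _) hq.le (by omega)
      linarith
    have hpow : ‖q‖ ^ ((s + 1) * (n + 1)) ≤ ‖q‖ ^ n :=
      pow_le_pow_of_le_one (norm_nonneg _) hq.le (by nlinarith)
    have hC0 : 0 ≤ C := (norm_nonneg _).trans (hC 0 0)
    calc _ = ‖phiProd q n / phiProd q (s + 1)‖ * ‖q‖ ^ ((s + 1) * (n + 1)) *
          (2 / ‖1 + q ^ (s + 1)‖) := by simp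
      _ ≤ C * ‖q‖ ^ n * (2 / (1 - ‖q‖)) := by
          gcongr
          exact hC _ _
      _ = _ := by ring
  have h := (tendsto_phiProd hq).add htail
  rw [add_zero] at h
  refine h.congr fun n ↦ ?_
  rw [phi_finite hq, Finset.sum_range_succ']
  simp only [pow_zero, zero_mul, one_mul, mul_one]
  rw [show phiProd q 0 = 1 by simp [phiProd, eulerProd_zero]]
  norm_num
  ring

/-- The partial product of `∏ (1 - q^{2k}) / (1 - q^{2k-1})`. -/
def psiProd (q : ℂ) (n : ℕ) : ℂ := eulerProd (q ^ 2) n ^ 2 / eulerProd q (2 * n)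

lemma psiProd_succ (hq : ‖q‖ < 1) (n : ℕ) :
    psiProd q (n + 1) = psiProd q n * ((1 - q ^ (2 * n + 2)) / (1 - q ^ (2 * n + 1))) := by
  have h1 := one_sub_pow_ne_zero hq (2 * n)
  have h2 := one_sub_pow_ne_zero hq (2 * n + 1)
  have h3 := eulerProd_ne_zero hq (2 * n)
  have h4 : (1 - (q ^ 2) ^ (n + 1)) = 1 - q ^ (2 * n + 2) := by ring
  rw [psiProd, psiProd, eulerProd_succ, h4, show 2 * (n + 1) = 2 * n + 1 + 1 by ring,
    eulerProd_succ, eulerProd_succ]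
  field_simp

lemma psiProd_ne_zero (hq : ‖q‖ < 1) (n : ℕ) : psiProd q n ≠ 0 :=
  div_ne_zero (pow_ne_zero _ (eulerProd_ne_zero (norm_pow_lt_one hq two_ne_zero) n))
    (eulerProd_ne_zero hq _)

lemma tendsto_psiProd (hq : ‖q‖ < 1) :
    Tendsto (psiProd q) atTop
      (𝓝 ((∏' n : ℕ, (1 - (q ^ 2) ^ (n + 1))) ^ 2 / ∏' n : ℕ, (1 - q ^ (n + 1)))) :=
  have h2 := norm_pow_lt_one hq two_ne_zero
  ((tendsto_eulerProd h2).pow 2).div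
    ((tendsto_eulerProd hq).comp (tendsto_id.const_mul_atTop' two_pos))
    (tprod_one_sub_pow_ne_zero hq)

lemma psi_telescope (hq : ‖q‖ < 1) (n m : ℕ) :
    ∑ s ∈ Finset.range (m + 1),
      ((psiProd q (n + 1) / psiProd q s) * q ^ (s * (2 * n + 3)) -
        (psiProd q n / psiProd q s) * q ^ (s * (2 * n + 1))) =
      (psiProd q n / psiProd q m) * q ^ ((m + 1) * (2 * n + 1)) * (1 - q ^ (2 * m + 1)) /
        (1 - q ^ (2 * n + 1)) := by
  induction m with
  | zero =>
    have h1 := one_sub_pow_ne_zero hq (2 * n)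
    have h5 := psiProd_ne_zero hq 0
    rw [Finset.sum_range_one, psiProd_succ hq n]
    simp only [zero_mul, pow_zero, mul_one, mul_zero, zero_add, one_mul, pow_one]
    field_simp
    ring
  | succ m ih =>
    have h1 := one_sub_pow_ne_zero hq (2 * n)
    have h2 := one_sub_pow_ne_zero hq (2 * m)
    have h3 := one_sub_pow_ne_zero hq (2 * m + 1)
    have h5 := psiProd_ne_zero hq m
    rw [Finset.sum_range_succ, ih, psiProd_succ hq m, psiProd_succ hq n]
    have e1 : q ^ ((m + 1) * (2 * n + 3)) = q ^ ((m + 1) * (2 * n + 1)) * q ^ (2 * m + 2) := by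
      ring
    have e2 : q ^ ((m + 1 + 1) * (2 * n + 1)) = q ^ ((m + 1) * (2 * n + 1)) * q ^ (2 * n + 1) := by
      ring
    have e3 : q ^ (2 * (m + 1) + 1) = q ^ (2 * m + 2) * q := by ring
    have e4 : q ^ (2 * n + 2) = q ^ (2 * n + 1) * q := by ring
    rw [e1, e2, e3, e4]
    change 1 - q ^ (2 * m + 2) ≠ 0 at h3
    generalize q ^ ((m + 1) * (2 * n + 1)) = X at *
    generalize q ^ (2 * n + 1) = Y at *
    generalize q ^ (2 * m + 1) = Z at *
    generalize q ^ (2 * m + 2) = W at *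
    field_simp
    ring

lemma psi_finite (hq : ‖q‖ < 1) (n : ℕ) :
    ∑ k ∈ Finset.range (2 * n + 1), q ^ (k * (k + 1) / 2) =
      ∑ s ∈ Finset.range (n + 1), (psiProd q n / psiProd q s) * q ^ (s * (2 * n + 1)) := by
  induction n with
  | zero =>
    have := psiProd_ne_zero hq 0
    norm_num [this]
  | succ n ih =>
    have h := psi_telescope hq n n
    rw [Finset.sum_sub_distrib, ← ih] at h
    rw [show 2 * (n + 1) + 1 = 2 * n + 3 by ring, Finset.sum_range_succ _ (n + 1),
      eq_add_of_sub_eq h, div_self (psiProd_ne_zero hq (n + 1)), div_self (psiProd_ne_zero hq n),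
      Finset.sum_range_succ _ (2 * n + 2), Finset.sum_range_succ _ (2 * n + 1)]
    have h1 := one_sub_pow_ne_zero hq (2 * n)
    have e1 : (2 * n + 1) * (2 * n + 1 + 1) / 2 = (n + 1) * (2 * n + 1) := by
      rw [show (2 * n + 1) * (2 * n + 1 + 1) = 2 * ((n + 1) * (2 * n + 1)) by ring]; simp
    have e2 : (2 * n + 2) * (2 * n + 2 + 1) / 2 = (n + 1) * (2 * n + 3) := by
      rw [show (2 * n + 2) * (2 * n + 2 + 1) = 2 * ((n + 1) * (2 * n + 3)) by ring]; simp
    rw [e1, e2]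
    field_simp
    ring

/-- Gauss's identity `ψ(q) = ∏ (1 - q^{2n})² / (1 - q^n)`. -/
theorem gauss_psi (hq : ‖q‖ < 1) :
    Tendsto (fun n ↦ ∑ k ∈ Finset.range (2 * n + 1), q ^ (k * (k + 1) / 2)) atTop
      (𝓝 ((∏' n : ℕ, (1 - (q ^ 2) ^ (n + 1))) ^ 2 / ∏' n : ℕ, (1 - q ^ (n + 1)))) := by
  have h2 := norm_pow_lt_one hq two_ne_zero
  obtain ⟨C, hC⟩ := exists_norm_div_le (tendsto_psiProd hq)
    (div_ne_zero (pow_ne_zero _ (tprod_one_sub_pow_ne_zero h2)) (tprod_one_sub_pow_ne_zero hq))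
  have htail := tendsto_sum_range_zero (r := ‖q‖) (C := C) (norm_nonneg q) hq
    (f := fun n s ↦ (psiProd q n / psiProd q (s + 1)) * q ^ ((s + 1) * (2 * n + 1))) fun n s ↦ by
    have hpow : ‖q‖ ^ ((s + 1) * (2 * n + 1)) ≤ ‖q‖ ^ n :=
      pow_le_pow_of_le_one (norm_nonneg _) hq.le (by nlinarith)
    have hC0 : 0 ≤ C := (norm_nonneg _).trans (hC 0 0)
    rw [norm_mul, norm_pow]
    gcongr
    exact hC _ _
  have h := (tendsto_psiProd hq).add htail
  rw [add_zero] at h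
  refine h.congr fun n ↦ ?_
  rw [psi_finite hq, Finset.sum_range_succ']
  simp only [zero_mul, pow_zero, mul_one]
  rw [show psiProd q 0 = 1 by simp [psiProd, eulerProd_zero]]
  ring

end Gauss

section Theta

/-- The principal binary quadratic form of discriminant `-7`. -/
def normForm (p : ℤ × ℤ) : ℤ := p.1 ^ 2 + p.1 * p.2 + 2 * p.2 ^ 2

lemma normForm_nonneg (p : ℤ × ℤ) : 0 ≤ normForm p := by
  unfold normForm
  nlinarith [sq_nonneg (2 * p.1 + p.2), sq_nonneg p.2]

lemma natAbs_add_natAbs_le (p : ℤ × ℤ) : p.1.natAbs + p.2.natAbs ≤ 2 * (normForm p).toNat := by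
  have h := normForm_nonneg p
  have h1 : |p.1| ≤ p.1 ^ 2 := by
    rw [← sq_abs]
    exact Int.le_self_sq _
  have h2 : |p.2| ≤ p.2 ^ 2 := by
    rw [← sq_abs]
    exact Int.le_self_sq _
  zify
  rw [Int.toNat_of_nonneg h]
  unfold normForm
  nlinarith [sq_nonneg (p.1 + p.2), sq_nonneg p.2]

/-- The theta series of the form `x² + xy + 2y²`. -/
def theta (q : ℂ) : ℂ := ∑' p : ℤ × ℤ, q ^ (normForm p).toNat

lemma summable_pow_natAbs {s : ℝ} (h0 : 0 ≤ s) (h1 : s < 1) :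
    Summable fun m : ℤ ↦ s ^ m.natAbs := by
  refine Summable.of_nat_of_neg_add_one ?_ ?_
  · simpa using summable_geometric_of_lt_one h0 h1
  · have := (summable_nat_add_iff 1).mpr (summable_geometric_of_lt_one h0 h1)
    exact this.congr fun n ↦ by congr 1

lemma summable_norm_theta {q : ℂ} (hq : ‖q‖ < 1) :
    Summable fun p : ℤ × ℤ ↦ ‖q ^ (normForm p).toNat‖ := by
  have hs0 : 0 ≤ √‖q‖ := Real.sqrt_nonneg _
  have hs1 : √‖q‖ < 1 := by
    rw [Real.sqrt_lt' one_pos]; simpa using hq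
  have h := summable_pow_natAbs hs0 hs1
  refine Summable.of_nonneg_of_le (fun _ ↦ norm_nonneg _) (fun p ↦ ?_)
    (h.mul_of_nonneg h (fun _ ↦ by positivity) (fun _ ↦ by positivity))
  rw [norm_pow, ← pow_add]
  nth_rw 1 [← Real.sq_sqrt (norm_nonneg q)]
  rw [← pow_mul]
  exact pow_le_pow_of_le_one hs0 hs1.le (natAbs_add_natAbs_le p)

lemma tsum_split {α β : Type*} {i j : α → β} (hij : Function.Bijective (Sum.elim i j))
    {f : β → ℂ} (hf : Summable f) : ∑' x, f x = ∑' x, f (i x) + ∑' x, f (j x) := by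
  have hi : Function.Injective i := fun x y h ↦ Sum.inl_injective (hij.1 (by simpa using h))
  have hj : Function.Injective j := fun x y h ↦ Sum.inr_injective (hij.1 (by simpa using h))
  refine HasSum.tsum_eq ?_
  rw [← (Equiv.ofBijective _ hij).hasSum_iff]
  exact HasSum.sum (hf.comp_injective hi).hasSum (hf.comp_injective hj).hasSum

lemma bijective_fst_parity :
    Function.Bijective (Sum.elim (fun p : ℤ × ℤ ↦ (2 * p.1, p.2))
      (fun p : ℤ × ℤ ↦ (2 * p.1 + 1, p.2))) := by
  constructor
  · rintro (⟨a, b⟩ | ⟨a, b⟩) (⟨c, d⟩ | ⟨c, d⟩) h <;>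
      simp only [Sum.elim_inl, Sum.elim_inr, Prod.mk.injEq] at h <;>
      simp only [Sum.inl.injEq, Sum.inr.injEq, Prod.mk.injEq, reduceCtorEq] <;> omega
  · rintro ⟨m, n⟩
    rcases Int.even_or_odd' m with ⟨k, rfl | rfl⟩
    · exact ⟨Sum.inl (k, n), rfl⟩
    · exact ⟨Sum.inr (k, n), rfl⟩

lemma bijective_shear_snd_parity :
    Function.Bijective (Sum.elim (fun p : ℤ × ℤ ↦ (p.1 - p.2, 2 * p.2))
      (fun p : ℤ × ℤ ↦ (p.1, 2 * p.2 + 1))) := by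
  constructor
  · rintro (⟨a, b⟩ | ⟨a, b⟩) (⟨c, d⟩ | ⟨c, d⟩) h <;>
      simp only [Sum.elim_inl, Sum.elim_inr, Prod.mk.injEq] at h <;>
      simp only [Sum.inl.injEq, Sum.inr.injEq, Prod.mk.injEq, reduceCtorEq] <;> omega
  · rintro ⟨m, n⟩
    rcases Int.even_or_odd' n with ⟨k, rfl | rfl⟩
    · exact ⟨Sum.inl (m + k, k), by simp⟩
    · exact ⟨Sum.inr (m, k), rfl⟩

lemma bijective_diff_parity :
    Function.Bijective (Sum.elim (fun p : ℤ × ℤ ↦ (p.1 + 2 * p.2, p.1))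
      (fun p : ℤ × ℤ ↦ (-1 - p.1 - 2 * p.2, p.1))) := by
  constructor
  · rintro (⟨a, b⟩ | ⟨a, b⟩) (⟨c, d⟩ | ⟨c, d⟩) h <;>
      simp only [Sum.elim_inl, Sum.elim_inr, Prod.mk.injEq] at h <;>
      simp only [Sum.inl.injEq, Sum.inr.injEq, Prod.mk.injEq, reduceCtorEq] <;> omega
  · rintro ⟨k, l⟩
    rcases Int.even_or_odd' (k - l) with ⟨n, h | h⟩
    · exact ⟨Sum.inl (l, n), by simp; omega⟩
    · exact ⟨Sum.inr (l, -1 - n - l), by simp; omega⟩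

variable {q : ℂ}

lemma summable_psi (hq : ‖q‖ < 1) : Summable fun k : ℕ ↦ ‖q ^ (k * (k + 1) / 2)‖ := by
  refine Summable.of_nonneg_of_le (fun _ ↦ norm_nonneg _) (fun k ↦ ?_)
    (summable_geometric_of_lt_one (norm_nonneg q) hq)
  rw [norm_pow]
  refine pow_le_pow_of_le_one (norm_nonneg _) hq.le ?_
  rw [Nat.le_div_iff_mul_le two_pos]
  rcases k with _ | k
  · simp
  · nlinarith

lemma summable_phi (hq : ‖q‖ < 1) :
    Summable fun k : ℕ ↦ ‖(-1) ^ (k + 1) * q ^ ((k + 1) ^ 2)‖ := by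
  refine Summable.of_nonneg_of_le (fun _ ↦ norm_nonneg _) (fun k ↦ ?_)
    (summable_geometric_of_lt_one (norm_nonneg q) hq)
  simp only [norm_mul, norm_pow, norm_neg, norm_one, one_pow, one_mul]
  exact pow_le_pow_of_le_one (norm_nonneg _) hq.le (by nlinarith)

lemma hasSum_int_psi (hq : ‖q‖ < 1) :
    HasSum (fun k : ℤ ↦ q ^ (k * (k + 1) / 2).toNat) (2 * ∑' k : ℕ, q ^ (k * (k + 1) / 2)) := by
  have h := (summable_psi hq).of_norm.hasSum
  rw [two_mul]
  refine HasSum.of_nat_of_neg_add_one (h.congr_fun fun n ↦ ?_) (h.congr_fun fun n ↦ ?_)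
  · congr 1
  · congr 1
    rw [show (-((n : ℤ) + 1)) * (-((n : ℤ) + 1) + 1) = n * (n + 1) by ring]
    rfl

lemma summable_norm_int_psi (hq : ‖q‖ < 1) :
    Summable fun k : ℤ ↦ ‖q ^ (k * (k + 1) / 2).toNat‖ := by
  have h := summable_psi hq
  refine Summable.of_nat_of_neg_add_one (h.congr fun n ↦ ?_) (h.congr fun n ↦ ?_)
  · congr 2
  · congr 2
    rw [show (-((n : ℤ) + 1)) * (-((n : ℤ) + 1) + 1) = n * (n + 1) by ring]
    rfl

lemma toNat_add_one_sq (n : ℕ) : (((n : ℤ) + 1) ^ 2).toNat = (n + 1) ^ 2 := by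
  rw [show ((n : ℤ) + 1) ^ 2 = (((n + 1) ^ 2 : ℕ) : ℤ) by push_cast; ring, Int.toNat_natCast]

lemma summable_norm_int_phi (hq : ‖q‖ < 1) :
    Summable fun k : ℤ ↦ ‖(-1) ^ k * q ^ (k ^ 2).toNat‖ := by
  have h := summable_phi hq
  refine Summable.of_nat_of_neg_add_one ((summable_nat_add_iff 1).mp (h.congr fun n ↦ ?_))
    (h.congr fun n ↦ ?_)
  · push_cast
    rw [toNat_add_one_sq]
    simp
  · rw [neg_sq, toNat_add_one_sq]
    simp

lemma neg_one_zpow_neg (k : ℤ) : (-1 : ℂ) ^ (-k) = (-1) ^ k := by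
  rw [zpow_neg, ← inv_zpow, inv_neg_one]

lemma tsum_int_of_even {f : ℤ → ℂ} (hf : ∀ k, f (-k) = f k)
    (hs : Summable fun n : ℕ ↦ f (n + 1)) :
    ∑' k, f k = f 0 + 2 * ∑' n : ℕ, f (n + 1) := by
  have h1 : Summable fun n : ℕ ↦ f n := by
    refine (summable_nat_add_iff 1).mp (hs.congr fun n ↦ ?_)
    push_cast
    rfl
  have h2 : ∀ n : ℕ, f (-((n : ℤ) + 1)) = f (n + 1) := fun n ↦ hf _
  rw [tsum_of_nat_of_neg_add_one h1 (hs.congr fun n ↦ (h2 n).symm), h1.tsum_eq_zero_add,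
    tsum_congr h2]
  push_cast
  ring

lemma tsum_int_phi (hq : ‖q‖ < 1) :
    ∑' k : ℤ, (-1) ^ k * q ^ (k ^ 2).toNat =
      1 + 2 * ∑' k : ℕ, (-1) ^ (k + 1) * q ^ ((k + 1) ^ 2) := by
  have h1 : ∀ n : ℕ, (-1 : ℂ) ^ ((n : ℤ) + 1) * q ^ (((n : ℤ) + 1) ^ 2).toNat =
      (-1) ^ (n + 1) * q ^ ((n + 1) ^ 2) := fun n ↦ by
    rw [toNat_add_one_sq, ← Nat.cast_succ, zpow_natCast]
  rw [tsum_int_of_even (fun k ↦ by rw [neg_sq, neg_one_zpow_neg])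
    ((summable_phi hq).of_norm.congr fun n ↦ (h1 n).symm), tsum_congr h1]
  simp

/-- The part of the theta series with odd first coordinate. -/
def thetaOdd (q : ℂ) : ℂ := ∑' p : ℤ × ℤ, q ^ (normForm (2 * p.1 + 1, p.2)).toNat

lemma tsum_even_eq_theta_sq (q : ℂ) :
    ∑' p : ℤ × ℤ, q ^ (normForm (2 * p.1, p.2)).toNat = theta (q ^ 2) := by
  rw [theta, ← (Equiv.prodComm ℤ ℤ).tsum_eq]
  refine tsum_congr fun p ↦ ?_
  have := normForm_nonneg p
  rw [← pow_mul]
  congr 1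
  have : normForm (2 * (Equiv.prodComm ℤ ℤ p).1, (Equiv.prodComm ℤ ℤ p).2) = 2 * normForm p := by
    simp [normForm]; ring
  omega

lemma theta_eq_add (hq : ‖q‖ < 1) : theta q = theta (q ^ 2) + thetaOdd q := by
  rw [theta, tsum_split bijective_fst_parity (summable_norm_theta hq).of_norm,
    tsum_even_eq_theta_sq, thetaOdd]

lemma thetaOdd_eq_psi (hq : ‖q‖ < 1) :
    thetaOdd q = 2 * (q * (∑' k : ℕ, q ^ (k * (k + 1) / 2)) *
      ∑' k : ℕ, (q ^ 7) ^ (k * (k + 1) / 2)) := by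
  have hq7 := norm_pow_lt_one hq (n := 7) (by norm_num)
  have hs := summable_mul_of_summable_norm (summable_norm_int_psi hq) (summable_norm_int_psi hq7)
  have hm := tsum_mul_tsum_of_summable_norm (summable_norm_int_psi hq) (summable_norm_int_psi hq7)
  rw [(hasSum_int_psi hq).tsum_eq, (hasSum_int_psi hq7).tsum_eq,
    tsum_split bijective_diff_parity hs] at hm
  have key : ∀ k l n : ℤ, k = l + 2 * n ∨ k = -1 - l - 2 * n →
      q * (q ^ (k * (k + 1) / 2).toNat * (q ^ 7) ^ (l * (l + 1) / 2).toNat) =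
        q ^ (normForm (2 * l + 1, n)).toNat := by
    intro k l n hk
    rw [← pow_mul, ← pow_add, ← pow_succ']
    congr 1
    have h1 : 2 * (k * (k + 1) / 2) = k * (k + 1) :=
      Int.mul_ediv_cancel' (Int.even_mul_succ_self k).two_dvd
    have h2 : 2 * (l * (l + 1) / 2) = l * (l + 1) :=
      Int.mul_ediv_cancel' (Int.even_mul_succ_self l).two_dvd
    have h3 : 0 ≤ k * (k + 1) := by
      rcases lt_or_ge k 0 with h | h <;> nlinarith
    have h4 : 0 ≤ l * (l + 1) := by
      rcases lt_or_ge l 0 with h | h <;> nlinarith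
    have h5 := normForm_nonneg (2 * l + 1, n)
    have h6 : 2 * normForm (2 * l + 1, n) = k * (k + 1) + 7 * (l * (l + 1)) + 2 := by
      rcases hk with rfl | rfl <;> simp only [normForm] <;> ring
    omega
  have e1 : ∀ p : ℤ × ℤ, q * (q ^ ((p.1 + 2 * p.2) * (p.1 + 2 * p.2 + 1) / 2).toNat *
      (q ^ 7) ^ (p.1 * (p.1 + 1) / 2).toNat) = q ^ (normForm (2 * p.1 + 1, p.2)).toNat :=
    fun p ↦ key _ _ _ (Or.inl rfl)
  have e2 : ∀ p : ℤ × ℤ, q * (q ^ ((-1 - p.1 - 2 * p.2) * (-1 - p.1 - 2 * p.2 + 1) / 2).toNat *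
      (q ^ 7) ^ (p.1 * (p.1 + 1) / 2).toNat) = q ^ (normForm (2 * p.1 + 1, p.2)).toNat :=
    fun p ↦ key _ _ _ (Or.inr rfl)
  have hm' : q * (2 * (∑' k : ℕ, q ^ (k * (k + 1) / 2)) *
      (2 * ∑' k : ℕ, (q ^ 7) ^ (k * (k + 1) / 2))) = thetaOdd q + thetaOdd q := by
    rw [hm, mul_add, ← tsum_mul_left, ← tsum_mul_left, tsum_congr e1, tsum_congr e2, thetaOdd]
  linear_combination (-1 / 2) * hm'

lemma phi_mul_phi (hq : ‖q‖ < 1) :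
    (1 + 2 * ∑' k : ℕ, (-1) ^ (k + 1) * q ^ ((k + 1) ^ 2)) *
      (1 + 2 * ∑' k : ℕ, (-1) ^ (k + 1) * (q ^ 7) ^ ((k + 1) ^ 2)) =
      theta (q ^ 2) - thetaOdd q := by
  have hq7 := norm_pow_lt_one hq (n := 7) (by norm_num)
  rw [← tsum_int_phi hq, ← tsum_int_phi hq7,
    tsum_mul_tsum_of_summable_norm (summable_norm_int_phi hq) (summable_norm_int_phi hq7)]
  have hf : Summable fun p : ℤ × ℤ ↦ (-1 : ℂ) ^ p.1 * q ^ (normForm p).toNat := by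
    refine Summable.of_norm ((summable_norm_theta hq).congr fun p ↦ ?_)
    simp
  have h1 := tsum_split bijective_fst_parity hf
  have h2 := tsum_split bijective_shear_snd_parity hf
  have h3 : ∑' p : ℤ × ℤ, (-1 : ℂ) ^ p.1 * q ^ (normForm (p.1, 2 * p.2 + 1)).toNat = 0 := by
    have hinv : Function.Involutive fun p : ℤ × ℤ ↦ ((-p.1 - (2 * p.2 + 1), p.2) : ℤ × ℤ) :=
      fun p ↦ by simp
    have h := (Function.Involutive.toPerm _ hinv).tsum_eq fun p : ℤ × ℤ ↦
      (-1 : ℂ) ^ p.1 * q ^ (normForm (p.1, 2 * p.2 + 1)).toNat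
    have h' : ∀ p : ℤ × ℤ, (-1 : ℂ) ^ (Function.Involutive.toPerm _ hinv p).1 *
        q ^ (normForm ((Function.Involutive.toPerm _ hinv p).1,
          2 * (Function.Involutive.toPerm _ hinv p).2 + 1)).toNat =
        -((-1 : ℂ) ^ p.1 * q ^ (normForm (p.1, 2 * p.2 + 1)).toNat) := fun p ↦ by
      change (-1 : ℂ) ^ (-p.1 - (2 * p.2 + 1)) *
        q ^ (normForm (-p.1 - (2 * p.2 + 1), 2 * p.2 + 1)).toNat = _
      have e : normForm (-p.1 - (2 * p.2 + 1), 2 * p.2 + 1) = normForm (p.1, 2 * p.2 + 1) := by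
        simp only [normForm]; ring
      rw [e, zpow_sub₀ (by norm_num), (odd_two_mul_add_one p.2).neg_one_zpow, zpow_neg,
        ← inv_zpow, inv_neg_one]
      ring
    rw [tsum_congr h', tsum_neg] at h
    exact self_eq_neg.mp h.symm
  have h4 : ∀ p : ℤ × ℤ, (-1 : ℂ) ^ (p.1 - p.2) * q ^ (normForm (p.1 - p.2, 2 * p.2)).toNat =
      (-1) ^ p.1 * q ^ (p.1 ^ 2).toNat * ((-1) ^ p.2 * (q ^ 7) ^ (p.2 ^ 2).toNat) := fun p ↦ by
    have e : (normForm (p.1 - p.2, 2 * p.2)).toNat = (p.1 ^ 2).toNat + 7 * (p.2 ^ 2).toNat := by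
      have h5 : normForm (p.1 - p.2, 2 * p.2) = p.1 ^ 2 + 7 * p.2 ^ 2 := by
        simp only [normForm]; ring
      have h6 := sq_nonneg p.1
      have h7 := sq_nonneg p.2
      omega
    rw [e, pow_add, pow_mul, zpow_sub₀ (by norm_num), div_eq_mul_inv, ← inv_zpow, inv_neg_one]
    ring
  have h5 : ∀ p : ℤ × ℤ, (-1 : ℂ) ^ (2 * p.1) * q ^ (normForm (2 * p.1, p.2)).toNat =
      q ^ (normForm (2 * p.1, p.2)).toNat := fun p ↦ by
    rw [(even_two_mul p.1).neg_one_zpow, one_mul]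
  have h6 : ∀ p : ℤ × ℤ, (-1 : ℂ) ^ (2 * p.1 + 1) * q ^ (normForm (2 * p.1 + 1, p.2)).toNat =
      -q ^ (normForm (2 * p.1 + 1, p.2)).toNat := fun p ↦ by
    rw [(odd_two_mul_add_one p.1).neg_one_zpow, neg_one_mul]
  simp only [h3, h4, add_zero] at h2
  simp only [h5, h6, tsum_neg, tsum_even_eq_theta_sq] at h1
  rw [← h2, h1, thetaOdd]
  ring

end Theta

section Liouville

/-- The quadratic character modulo `7`. -/
def chi (a : ZMod 7) : ℤ := if a = 0 then 0 else if a = 1 ∨ a = 2 ∨ a = 4 then 1 else -1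

/-- Quadruples `((a, b), (x, y))` of positive integers with `a x + b y = n`. -/
def quads (n : ℕ) : Finset ((ℕ × ℕ) × (ℕ × ℕ)) :=
  ((Finset.Icc 1 n ×ˢ Finset.Icc 1 n) ×ˢ (Finset.Icc 1 n ×ˢ Finset.Icc 1 n)).filter
    fun p ↦ p.1.1 * p.2.1 + p.1.2 * p.2.2 = n

lemma mem_quads {n a b x y : ℕ} :
    ((a, b), (x, y)) ∈ quads n ↔ 0 < a ∧ 0 < b ∧ 0 < x ∧ 0 < y ∧ a * x + b * y = n := by
  simp only [quads, Finset.mem_filter, Finset.mem_product, Finset.mem_Icc]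
  constructor
  · rintro ⟨⟨⟨h1, h2⟩, h3, h4⟩, h⟩
    exact ⟨h1.1, h2.1, h3.1, h4.1, h⟩
  · rintro ⟨h1, h2, h3, h4, rfl⟩
    have := Nat.le_mul_of_pos_right a h3
    have := Nat.le_mul_of_pos_left x h1
    have := Nat.le_mul_of_pos_right b h4
    have := Nat.le_mul_of_pos_left y h2
    refine ⟨⟨⟨⟨?_, ?_⟩, ?_, ?_⟩, ⟨?_, ?_⟩, ?_, ?_⟩, rfl⟩ <;> omega

lemma sum_quads_trichotomy {n : ℕ} (u v : (ℕ × ℕ) × (ℕ × ℕ) → ℕ)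
    (F : (ℕ × ℕ) × (ℕ × ℕ) → ℤ) :
    ∑ p ∈ quads n, F p = ∑ p ∈ quads n with u p < v p, F p + ∑ p ∈ quads n with u p = v p, F p +
      ∑ p ∈ quads n with v p < u p, F p := by
  simp only [Finset.sum_filter, ← Finset.sum_add_distrib]
  refine Finset.sum_congr rfl fun p _ ↦ ?_
  rcases lt_trichotomy (u p) (v p) with h | h | h
  · simp [h, h.ne, h.not_gt]
  · simp [h]
  · simp [h, h.ne', h.not_gt]

lemma sum_quads_shear {n : ℕ} (F : ℕ → ℕ → ℤ) :
    ∑ p ∈ quads n with p.2.1 < p.2.2, F p.1.1 p.1.2 =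
      ∑ p ∈ quads n with p.1.2 < p.1.1, F (p.1.1 - p.1.2) p.1.2 := by
  refine Finset.sum_nbij' (fun p ↦ ((p.1.1 + p.1.2, p.1.2), (p.2.1, p.2.2 - p.2.1)))
    (fun p ↦ ((p.1.1 - p.1.2, p.1.2), (p.2.1, p.2.1 + p.2.2))) ?_ ?_ ?_ ?_ ?_
  · rintro ⟨⟨a, b⟩, x, y⟩ h
    simp only [Finset.mem_filter, mem_quads] at h ⊢
    obtain ⟨⟨h1, h2, h3, h4, h5⟩, h6⟩ := h
    obtain ⟨k, rfl⟩ := Nat.exists_eq_add_of_lt h6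
    refine ⟨⟨by omega, h2, h3, by omega, ?_⟩, by omega⟩
    rw [show x + k + 1 - x = k + 1 by omega, ← h5]
    ring
  · rintro ⟨⟨a, b⟩, x, y⟩ h
    simp only [Finset.mem_filter, mem_quads] at h ⊢
    obtain ⟨⟨h1, h2, h3, h4, h5⟩, h6⟩ := h
    obtain ⟨k, rfl⟩ := Nat.exists_eq_add_of_lt h6
    refine ⟨⟨by omega, h2, h3, by omega, ?_⟩, by omega⟩
    rw [show b + k + 1 - b = k + 1 by omega, ← h5]
    ring
  · rintro ⟨⟨a, b⟩, x, y⟩ h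
    simp only [Finset.mem_filter] at h
    simp only [Prod.mk.injEq, true_and, and_true]
    omega
  · rintro ⟨⟨a, b⟩, x, y⟩ h
    simp only [Finset.mem_filter] at h
    simp only [Prod.mk.injEq, true_and, and_true]
    omega
  · rintro ⟨⟨a, b⟩, x, y⟩ h
    simp

lemma sum_quads_swap {n : ℕ} (P : (ℕ × ℕ) × (ℕ × ℕ) → Prop) [DecidablePred P]
    (F : (ℕ × ℕ) × (ℕ × ℕ) → ℤ) :
    ∑ p ∈ quads n with P p, F p =
      ∑ p ∈ quads n with P (p.1.swap, p.2.swap), F (p.1.swap, p.2.swap) := by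
  refine Finset.sum_nbij' (fun p ↦ (p.1.swap, p.2.swap)) (fun p ↦ (p.1.swap, p.2.swap))
    ?_ ?_ ?_ ?_ ?_
  · rintro ⟨⟨a, b⟩, x, y⟩ h
    simp only [Finset.mem_filter, mem_quads, Prod.swap_prod_mk] at h ⊢
    exact ⟨⟨h.1.2.1, h.1.1, h.1.2.2.2.1, h.1.2.2.1, by linarith [h.1.2.2.2.2]⟩, h.2⟩
  · rintro ⟨⟨a, b⟩, x, y⟩ h
    simp only [Finset.mem_filter, mem_quads, Prod.swap_prod_mk] at h ⊢
    exact ⟨⟨h.1.2.1, h.1.1, h.1.2.2.2.1, h.1.2.2.1, by linarith [h.1.2.2.2.2]⟩, h.2⟩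
  · simp
  · simp
  · simp

lemma sum_quads_dual {n : ℕ} (F : ℕ → ℤ) :
    ∑ p ∈ quads n with p.1.1 = p.1.2, F p.1.1 = ∑ p ∈ quads n with p.2.1 = p.2.2, F p.2.1 := by
  refine Finset.sum_nbij' Prod.swap Prod.swap ?_ ?_ ?_ ?_ ?_
  · rintro ⟨⟨a, b⟩, x, y⟩ h
    simp only [Finset.mem_filter, mem_quads, Prod.swap_prod_mk] at h ⊢
    exact ⟨⟨h.1.2.2.1, h.1.2.2.2.1, h.1.1, h.1.2.1, by linarith [h.1.2.2.2.2]⟩, h.2⟩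
  · rintro ⟨⟨a, b⟩, x, y⟩ h
    simp only [Finset.mem_filter, mem_quads, Prod.swap_prod_mk] at h ⊢
    exact ⟨⟨h.1.2.2.1, h.1.2.2.2.1, h.1.1, h.1.2.1, by linarith [h.1.2.2.2.2]⟩, h.2⟩
  · simp
  · simp
  · simp

lemma sum_quads_diag {n : ℕ} (F : ℕ → ℕ → ℕ → ℤ) :
    ∑ p ∈ quads n with p.2.1 = p.2.2, F (p.1.1 + p.1.2) p.1.2 p.2.1 =
      ∑ d ∈ n.divisors, ∑ b ∈ Finset.Ico 1 d, F d b (n / d) := by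
  rw [Finset.sum_sigma']
  refine Finset.sum_bij' (fun p _ ↦ ⟨p.1.1 + p.1.2, p.1.2⟩)
    (fun s _ ↦ ((s.1 - s.2, s.2), (n / s.1, n / s.1))) ?_ ?_ ?_ ?_ ?_
  · rintro ⟨⟨a, b⟩, x, y⟩ h
    simp only [Finset.mem_filter, mem_quads] at h
    obtain ⟨⟨h1, h2, h3, h4, h5⟩, rfl⟩ := h
    simp only [Finset.mem_sigma, Nat.mem_divisors, Finset.mem_Ico]
    refine ⟨⟨⟨x, by rw [← h5]; ring⟩, ?_⟩, h2, by omega⟩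
    have := Nat.mul_pos h1 h3
    omega
  · rintro ⟨d, b⟩ h
    simp only [Finset.mem_sigma, Nat.mem_divisors, Finset.mem_Ico] at h
    obtain ⟨⟨⟨k, rfl⟩, hn⟩, h1, h2⟩ := h
    have hd : 0 < d := by omega
    have hk : 0 < k := Nat.pos_of_ne_zero (right_ne_zero_of_mul hn)
    simp only [Finset.mem_filter, mem_quads, Nat.mul_div_cancel_left k hd, and_true]
    refine ⟨by omega, by omega, hk, hk, ?_⟩
    rw [← add_mul, Nat.sub_add_cancel h2.le]
  · rintro ⟨⟨a, b⟩, x, y⟩ h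
    simp only [Finset.mem_filter, mem_quads] at h
    obtain ⟨⟨h1, h2, h3, h4, h5⟩, rfl⟩ := h
    have : n / (a + b) = x := by
      rw [← h5, ← add_mul, Nat.mul_div_cancel_left x (by omega)]
    simp [this]
  · rintro ⟨d, b⟩ h
    simp only [Finset.mem_sigma, Finset.mem_Ico] at h
    simp [Nat.sub_add_cancel h.2.2.le]
  · rintro ⟨⟨a, b⟩, x, y⟩ h
    simp only [Finset.mem_filter, mem_quads] at h
    obtain ⟨⟨h1, h2, h3, h4, h5⟩, rfl⟩ := h
    have : n / (a + b) = x := by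
      rw [← h5, ← add_mul, Nat.mul_div_cancel_left x (by omega)]
    simp [this]

/-- Liouville's elementary method, for a symmetric function odd in each variable. -/
theorem liouville {R : Type*} [CommRing R] (n : ℕ) (h : R → R → ℤ) (hsymm : ∀ a b, h a b = h b a)
    (hodd : ∀ a b, h a (-b) = -h a b) :
    2 * ∑ p ∈ quads n, (h (p.1.1 + p.1.2) p.1.2 + h (p.1.1 - p.1.2) p.1.2) =
      2 * ∑ p ∈ quads n, h p.1.1 p.1.2 - ∑ d ∈ n.divisors, ∑ b ∈ Finset.Ico 1 d,
        (h (n / d : ℕ) (n / d : ℕ) + h (d - b) b - 2 * h d b) := by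
  have hzero : ∀ a, h a 0 = 0 := fun a ↦ by
    have := hodd a 0
    rw [neg_zero] at this
    omega
  have hodd' : ∀ a b, h (a - b) b = -h b (b - a) := fun a b ↦ by
    rw [hsymm, ← neg_sub, hodd]
  -- the three regions for the sum of `h (a + b) b`
  have t1 := sum_quads_trichotomy (n := n) (fun p ↦ p.2.1) (fun p ↦ p.2.2)
    (fun p ↦ h (p.1.1 + p.1.2) p.1.2)
  have a1 : ∑ p ∈ quads n with p.2.1 < p.2.2, h (p.1.1 + p.1.2) p.1.2 =
      ∑ p ∈ quads n with p.1.2 < p.1.1, h p.1.1 p.1.2 := by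
    rw [sum_quads_shear (fun a b ↦ h (a + b) b)]
    refine Finset.sum_congr rfl fun p hp ↦ ?_
    rw [Nat.cast_sub (Finset.mem_filter.mp hp).2.le, sub_add_cancel]
  have a2 : ∑ p ∈ quads n with p.2.2 < p.2.1, h (p.1.1 + p.1.2) p.1.2 =
      ∑ p ∈ quads n with p.1.1 < p.1.2, h p.1.2 (p.1.2 - p.1.1) := by
    rw [sum_quads_swap, sum_quads_swap (fun p ↦ p.1.1 < p.1.2)]
    simp only [Prod.fst_swap, Prod.snd_swap]
    rw [sum_quads_shear (fun a b ↦ h (b + a) a)]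
    refine Finset.sum_congr rfl fun p hp ↦ ?_
    rw [Nat.cast_sub (Finset.mem_filter.mp hp).2.le, add_sub_cancel]
  have t2 := sum_quads_trichotomy (n := n) (fun p ↦ p.1.1) (fun p ↦ p.1.2)
    (fun p ↦ h p.1.2 (p.1.2 - p.1.1))
  have a3 : ∑ p ∈ quads n with p.1.1 = p.1.2, h p.1.2 (p.1.2 - p.1.1) = 0 :=
    Finset.sum_eq_zero fun p hp ↦ by rw [(Finset.mem_filter.mp hp).2, sub_self, hzero]
  have a4 : ∑ p ∈ quads n with p.1.2 < p.1.1, h p.1.2 (p.1.2 - p.1.1) =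
      -∑ p ∈ quads n with p.2.1 < p.2.2, h p.1.1 p.1.2 := by
    rw [sum_quads_shear (fun a b ↦ h a b), ← Finset.sum_neg_distrib]
    refine Finset.sum_congr rfl fun p hp ↦ ?_
    rw [Nat.cast_sub (Finset.mem_filter.mp hp).2.le, hodd', neg_neg]
  have t3 := sum_quads_trichotomy (n := n) (fun p ↦ p.1.1) (fun p ↦ p.1.2)
    (fun p ↦ h p.1.1 p.1.2)
  have t4 := sum_quads_trichotomy (n := n) (fun p ↦ p.2.1) (fun p ↦ p.2.2)
    (fun p ↦ h p.1.1 p.1.2)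
  have a5 : ∑ p ∈ quads n with p.1.1 < p.1.2, h p.1.1 p.1.2 =
      ∑ p ∈ quads n with p.1.2 < p.1.1, h p.1.1 p.1.2 := by
    rw [sum_quads_swap]
    exact Finset.sum_congr rfl fun p _ ↦ hsymm _ _
  have a6 : ∑ p ∈ quads n with p.2.2 < p.2.1, h p.1.1 p.1.2 =
      ∑ p ∈ quads n with p.2.1 < p.2.2, h p.1.1 p.1.2 := by
    rw [sum_quads_swap]
    exact Finset.sum_congr rfl fun p _ ↦ hsymm _ _
  have a7 : ∑ p ∈ quads n with p.1.1 = p.1.2, h p.1.1 p.1.2 =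
      ∑ p ∈ quads n with p.2.1 = p.2.2, h p.2.1 p.2.1 := by
    rw [← sum_quads_dual (fun a ↦ h a a)]
    exact Finset.sum_congr rfl fun p hp ↦ by rw [(Finset.mem_filter.mp hp).2]
  have d := sum_quads_diag (n := n) (fun d b x ↦ h x x + h (d - b) b - 2 * h d b)
  simp only [Nat.cast_add, add_sub_cancel_right, Finset.sum_sub_distrib, Finset.sum_add_distrib,
    ← Finset.mul_sum] at d
  simp only [Finset.sum_add_distrib, hodd', Finset.sum_neg_distrib, Finset.sum_sub_distrib,
    ← Finset.mul_sum] at *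
  linarith

/-- The auxiliary kernel whose Liouville transform is a multiple of `χ ⊗ χ`. -/
def kernel (a b : ZMod 7) : ℤ :=
  3 * (chi a * chi b) + if a = 0 then 0 else 4 * ((if a = b then 1 else 0) - if a = -b then 1 else 0)

lemma kernel_symm : ∀ a b, kernel a b = kernel b a := by decide

lemma kernel_neg : ∀ a b, kernel a (-b) = -kernel a b := by decide

lemma kernel_transform : ∀ a b : ZMod 7,
    8 * (chi a * chi b) = 2 * kernel a b - (kernel (a + b) b + kernel (a - b) b) -
      (kernel (b + a) a + kernel (b - a) a) := by decide

lemma sum_kernel_period : ∀ r : ZMod 7,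
    ∑ i ∈ Finset.range 7, (kernel (r - (r + i)) (r + i) - 2 * kernel r (r + i)) =
      if r = 0 then -42 else 7 := by decide

lemma sum_kernel (d : ℕ) :
    ∑ b ∈ Finset.range d, (kernel (d - b) b - 2 * kernel d b) =
      (if (d : ZMod 7) = 0 then -6 * (d : ℤ) else d + 7) - 8 * chi d := by
  have base : ∀ r < 7, ∑ b ∈ Finset.range r, (kernel ((r : ℕ) - (b : ℕ)) b - 2 * kernel r b) =
      (if (r : ZMod 7) = 0 then -6 * (r : ℤ) else r + 7) - 8 * chi r := by decide
  have step : ∀ r k : ℕ, r < 7 →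
      ∑ b ∈ Finset.range (r + 7 * k), (kernel (r - b) b - 2 * kernel r b) =
      (if (r : ZMod 7) = 0 then -6 * ((r + 7 * k : ℕ) : ℤ) else (r + 7 * k : ℕ) + 7) -
        8 * chi r := by
    intro r k hr
    induction k with
    | zero => exact base r hr
    | succ k ih =>
      have h7 : (7 : ZMod 7) = 0 := rfl
      rw [mul_add, mul_one, ← add_assoc, Finset.sum_range_add, ih]
      have := sum_kernel_period r
      simp only [Nat.cast_add, Nat.cast_mul, Nat.cast_ofNat, h7, zero_mul, add_zero] at this ⊢
      rw [this]
      split_ifs <;> ring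
  have h := step (d % 7) (d / 7) (Nat.mod_lt _ (by norm_num))
  rw [Nat.mod_add_div, ZMod.natCast_mod] at h
  exact h

/-- `∑_{d ∣ n} χ(d)`. -/
def chiSum (n : ℕ) : ℤ := ∑ d ∈ n.divisors, chi d

/-- The sum of the divisors of `n` prime to `7`. -/
def sigmaSeven (n : ℕ) : ℤ := ∑ d ∈ n.divisors, if (d : ZMod 7) = 0 then 0 else (d : ℤ)

lemma sum_divisors_cofactor (n : ℕ) :
    ∑ d ∈ n.divisors, (if ((n / d : ℕ) : ZMod 7) = 0 then 7 * (d : ℤ) else 0) =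
      ∑ d ∈ n.divisors, if (d : ZMod 7) = 0 then (d : ℤ) else 0 := by
  rw [← Finset.sum_filter, ← Finset.sum_filter]
  refine Finset.sum_nbij' (fun d ↦ 7 * d) (fun d ↦ d / 7) ?_ ?_ ?_ ?_ ?_
  · intro d hd
    simp only [Finset.mem_filter, Nat.mem_divisors, ZMod.natCast_eq_zero_iff] at hd ⊢
    obtain ⟨⟨⟨k, rfl⟩, hn⟩, h7⟩ := hd
    rw [Nat.mul_div_cancel_left k (Nat.pos_of_ne_zero (left_ne_zero_of_mul hn))] at h7
    exact ⟨⟨by rw [mul_comm]; exact Nat.mul_dvd_mul_left d h7, hn⟩, dvd_mul_right _ _⟩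
  · intro d hd
    simp only [Finset.mem_filter, Nat.mem_divisors, ZMod.natCast_eq_zero_iff] at hd ⊢
    obtain ⟨⟨⟨k, rfl⟩, hn⟩, e, rfl⟩ := hd
    have he : 0 < e := by
      rcases e with _ | e
      · simp at hn
      · omega
    rw [Nat.mul_div_cancel_left e (by norm_num), mul_assoc, mul_left_comm,
      Nat.mul_div_cancel_left _ he]
    exact ⟨⟨dvd_mul_right _ _, by rw [mul_left_comm, ← mul_assoc]; exact hn⟩, dvd_mul_right _ _⟩
  · intro d _
    simp
  · intro d hd
    simp only [Finset.mem_filter, ZMod.natCast_eq_zero_iff] at hd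
    exact Nat.mul_div_cancel' hd.2
  · intro d _
    push_cast
    rfl

theorem sum_quads_chi (n : ℕ) :
    ∑ p ∈ quads n, chi p.1.1 * chi p.1.2 = sigmaSeven n - chiSum n := by
  have h1 := liouville n kernel kernel_symm kernel_neg
  have h2 : ∑ p ∈ quads n, (kernel (p.1.2 + p.1.1) p.1.1 + kernel (p.1.2 - p.1.1) p.1.1) =
      ∑ p ∈ quads n, (kernel (p.1.1 + p.1.2) p.1.2 + kernel (p.1.1 - p.1.2) p.1.2) := by
    have := sum_quads_swap (n := n) (fun _ ↦ True)
      (fun p ↦ kernel (p.1.1 + p.1.2) p.1.2 + kernel (p.1.1 - p.1.2) p.1.2)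
    simpa using this.symm
  have h3 : 8 * ∑ p ∈ quads n, chi p.1.1 * chi p.1.2 =
      ∑ d ∈ n.divisors, ∑ b ∈ Finset.Ico 1 d, (kernel (n / d : ℕ) (n / d : ℕ) +
        kernel (d - b) b - 2 * kernel d b) := by
    rw [Finset.mul_sum, Finset.sum_congr rfl fun p _ ↦ kernel_transform _ _,
      Finset.sum_sub_distrib, Finset.sum_sub_distrib, h2, ← Finset.mul_sum]
    linarith
  have hdiag : ∀ a : ZMod 7, kernel a a = if a = 0 then 0 else 7 := by decide
  have hz : ∀ a : ZMod 7, kernel a 0 = 0 := by decide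
  have h4 : ∀ d ∈ n.divisors, ∑ b ∈ Finset.Ico 1 d, (kernel (n / d : ℕ) (n / d : ℕ) +
        kernel (d - b) b - 2 * kernel d b) =
      8 * (if (d : ZMod 7) = 0 then 0 else (d : ℤ)) - 8 * chi d
        + ((if (d : ZMod 7) = 0 then 0 else 7) - (if ((n / d : ℕ) : ZMod 7) = 0 then 0 else 7))
        + (if (d : ZMod 7) = 0 then (d : ℤ) else 0)
        - (if ((n / d : ℕ) : ZMod 7) = 0 then 7 * (d : ℤ) else 0)
        + 7 * ((d : ℤ) - (if (d : ZMod 7) = 0 then (d : ℤ) else 0) -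
          (if (d : ZMod 7) = 0 then 0 else (d : ℤ))) := by
    intro d hd
    have hd0 : 0 < d := Nat.pos_of_mem_divisors hd
    have h5 := sum_kernel d
    rw [Finset.range_eq_Ico, Finset.sum_eq_sum_Ico_succ_bot hd0] at h5
    simp only [Nat.cast_zero, hz, mul_zero, sub_zero, zero_add] at h5
    simp only [add_sub_assoc, Finset.sum_add_distrib, h5, Finset.sum_const, Nat.card_Ico,
      nsmul_eq_mul, hdiag, Nat.cast_sub (show 1 ≤ d from hd0)]
    split_ifs <;> push_cast <;> ring
  have h6 : ∑ d ∈ n.divisors, (if ((n / d : ℕ) : ZMod 7) = 0 then (0 : ℤ) else 7) =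
      ∑ d ∈ n.divisors, if (d : ZMod 7) = 0 then 0 else 7 :=
    Nat.sum_div_divisors n fun d ↦ if (d : ZMod 7) = 0 then (0 : ℤ) else 7
  have h7 : ∀ d : ℕ, (d : ℤ) - (if (d : ZMod 7) = 0 then (d : ℤ) else 0) -
      (if (d : ZMod 7) = 0 then 0 else (d : ℤ)) = 0 := fun d ↦ by split_ifs <;> ring
  rw [Finset.sum_congr rfl h4] at h3
  simp only [h7, mul_zero, add_zero, Finset.sum_sub_distrib, Finset.sum_add_distrib,
    ← Finset.mul_sum, h6, sum_divisors_cofactor] at h3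
  rw [sigmaSeven, chiSum]
  linarith

lemma sum_antidiagonal_chiSum (n : ℕ) :
    ∑ p ∈ Finset.HasAntidiagonal.antidiagonal n, chiSum p.1 * chiSum p.2 =
      ∑ p ∈ quads n, chi p.1.1 * chi p.1.2 := by
  have hc : ∀ m, chiSum m = ∑ p ∈ m.divisorsAntidiagonal, chi p.1 := fun m ↦
    (Nat.sum_divisorsAntidiagonal fun d _ ↦ chi d).symm
  simp only [hc, Finset.sum_mul_sum, ← Finset.sum_product']
  rw [Finset.sum_sigma']
  refine Finset.sum_bij' (fun s _ ↦ ((s.2.1.1, s.2.2.1), (s.2.1.2, s.2.2.2)))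
    (fun p _ ↦ ⟨(p.1.1 * p.2.1, p.1.2 * p.2.2), ((p.1.1, p.2.1), (p.1.2, p.2.2))⟩) ?_ ?_ ?_ ?_ ?_
  · rintro ⟨⟨i, j⟩, ⟨a, x⟩, ⟨b, y⟩⟩ h
    simp only [Finset.mem_sigma, Finset.HasAntidiagonal.mem_antidiagonal, Finset.mem_product,
      Nat.mem_divisorsAntidiagonal] at h
    obtain ⟨rfl, ⟨rfl, h1⟩, rfl, h2⟩ := h
    rw [mem_quads]
    simp only [ne_eq, mul_eq_zero, not_or] at h1 h2
    exact ⟨Nat.pos_of_ne_zero h1.1, Nat.pos_of_ne_zero h2.1, Nat.pos_of_ne_zero h1.2,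
      Nat.pos_of_ne_zero h2.2, rfl⟩
  · rintro ⟨⟨a, b⟩, x, y⟩ h
    rw [mem_quads] at h
    obtain ⟨h1, h2, h3, h4, rfl⟩ := h
    simp only [Finset.mem_sigma, Finset.HasAntidiagonal.mem_antidiagonal, Finset.mem_product,
      Nat.mem_divisorsAntidiagonal]
    exact ⟨trivial, ⟨trivial, by positivity⟩, trivial, by positivity⟩
  · rintro ⟨⟨i, j⟩, ⟨a, x⟩, ⟨b, y⟩⟩ h
    simp only [Finset.mem_sigma, Finset.HasAntidiagonal.mem_antidiagonal, Finset.mem_product,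
      Nat.mem_divisorsAntidiagonal] at h
    obtain ⟨rfl, ⟨rfl, h1⟩, rfl, h2⟩ := h
    rfl
  · rintro ⟨⟨a, b⟩, x, y⟩ h
    rfl
  · rintro ⟨⟨i, j⟩, ⟨a, x⟩, ⟨b, y⟩⟩ h
    rfl

end Liouville

section NormForm

instance : Nontrivial (QuadraticAlgebra ℤ (-2) 1) :=
  ⟨⟨0, 1, fun h ↦ by
    have := congrArg QuadraticAlgebra.re h
    rw [QuadraticAlgebra.re_zero, QuadraticAlgebra.re_one] at this
    exact zero_ne_one this⟩⟩

lemma quadNorm_eq (z : QuadraticAlgebra ℤ (-2) 1) :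
    z.norm = z.re ^ 2 + z.re * z.im + 2 * z.im ^ 2 := by
  rw [QuadraticAlgebra.norm_def]; ring

lemma quadNorm_nonneg (z : QuadraticAlgebra ℤ (-2) 1) : 0 ≤ z.norm := by
  rw [quadNorm_eq]; nlinarith [sq_nonneg (2 * z.re + z.im), sq_nonneg z.im]

lemma quadNorm_eq_zero {z : QuadraticAlgebra ℤ (-2) 1} : z.norm = 0 ↔ z = 0 := by
  refine ⟨fun h ↦ ?_, fun h ↦ by simp [h]⟩
  rw [quadNorm_eq] at h
  have h1 : z.im = 0 := by
    have : z.im ^ 2 = 0 := by nlinarith [sq_nonneg (2 * z.re + z.im), sq_nonneg z.im]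
    exact pow_eq_zero_iff (by norm_num) |>.1 this
  have h2 : z.re = 0 := by simpa [h1] using h
  ext <;> simpa

instance : NoZeroDivisors (QuadraticAlgebra ℤ (-2) 1) where
  eq_zero_or_eq_zero_of_mul_eq_zero {a b} h := by
    have h := congrArg QuadraticAlgebra.norm h
    rwa [map_mul, QuadraticAlgebra.norm_zero, mul_eq_zero, quadNorm_eq_zero, quadNorm_eq_zero] at h

instance : IsDomain (QuadraticAlgebra ℤ (-2) 1) := NoZeroDivisors.to_isDomain _

/-- Division of integers with a remainder of least absolute value. -/
lemma exists_round (a : ℤ) {m : ℤ} (hm : 0 < m) : ∃ u : ℤ, 2 * |a - m * u| ≤ m := by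
  refine ⟨(2 * a + m) / (2 * m), ?_⟩
  have h1 := Int.emod_add_mul_ediv (2 * a + m) (2 * m)
  have h2 := Int.emod_nonneg (2 * a + m) (show 2 * m ≠ 0 by omega)
  have h3 := Int.emod_lt_of_pos (2 * a + m) (show 0 < 2 * m by omega)
  set v := (2 * a + m) / (2 * m)
  have : |2 * (a - m * v)| ≤ m := abs_le.2 ⟨by linarith, by linarith⟩
  rwa [abs_mul, abs_two] at this

lemma exists_norm_sub_lt (x : QuadraticAlgebra ℤ (-2) 1) {y : QuadraticAlgebra ℤ (-2) 1}
    (hy : y ≠ 0) : ∃ w : QuadraticAlgebra ℤ (-2) 1, (x - y * w).norm < y.norm := by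
  have hm : 0 < y.norm := lt_of_le_of_ne (quadNorm_nonneg y) fun h ↦ hy (quadNorm_eq_zero.1 h.symm)
  set m := y.norm with hmdef
  obtain ⟨v, hv⟩ := exists_round (x * star y).im hm
  obtain ⟨u, hu⟩ := exists_round (2 * (x * star y).re + ((x * star y).im - m * v))
    (m := 2 * m) (by omega)
  refine ⟨⟨u, v⟩, ?_⟩
  have h1 : ((x - y * ⟨u, v⟩) * star y).norm = (x - y * ⟨u, v⟩).norm * m := by
    rw [map_mul, QuadraticAlgebra.norm_star]
  have h2 : (x - y * ⟨u, v⟩) * star y = x * star y - algebraMap ℤ _ m * ⟨u, v⟩ := by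
    rw [hmdef, QuadraticAlgebra.algebraMap_norm_eq_mul_star]; ring
  set A := (x * star y).re
  set B := (x * star y).im
  have h3 : (x * star y - algebraMap ℤ (QuadraticAlgebra ℤ (-2) 1) m * ⟨u, v⟩).norm
      = (A - m * u) ^ 2 + (A - m * u) * (B - m * v) + 2 * (B - m * v) ^ 2 := by
    rw [quadNorm_eq]; simp [A, B]
  rw [h2, h3] at h1
  have e1 : (2 * (B - m * v)) ^ 2 ≤ m ^ 2 := by
    rw [← sq_abs, abs_mul, abs_two]
    exact pow_le_pow_left₀ (by positivity) hv 2
  have e2 : (2 * (A - m * u) + (B - m * v)) ^ 2 ≤ m ^ 2 := by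
    have : 2 * A + (B - m * v) - 2 * m * u = 2 * (A - m * u) + (B - m * v) := by ring
    rw [this] at hu
    rw [← sq_abs]
    exact pow_le_pow_left₀ (by positivity) (by linarith) 2
  nlinarith

instance : EuclideanDomain (QuadraticAlgebra ℤ (-2) 1) where
  toCommRing := inferInstance
  exists_pair_ne := exists_pair_ne _
  quotient x y := by
    classical exact if h : y = 0 then 0 else (exists_norm_sub_lt x h).choose
  quotient_zero _ := by simp
  remainder x y := by
    classical exact x - y * (if h : y = 0 then 0 else (exists_norm_sub_lt x h).choose)
  quotient_mul_add_remainder_eq _ _ := add_sub_cancel _ _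
  r x y := x.norm.natAbs < y.norm.natAbs
  r_wellFounded := (measure _).wf
  remainder_lt x y hy := by
    have := (exists_norm_sub_lt x hy).choose_spec
    have h := quadNorm_nonneg (x - y * (exists_norm_sub_lt x hy).choose)
    simp only [hy, dite_false]
    change Int.natAbs _ < Int.natAbs _
    omega
  mul_left_not_lt x y hy := by
    have h1 := quadNorm_nonneg x
    have h2 := quadNorm_nonneg y
    have h3 : y.norm ≠ 0 := fun h ↦ hy (quadNorm_eq_zero.1 h)
    change ¬ Int.natAbs _ < Int.natAbs _
    rw [map_mul, Int.natAbs_mul, not_lt]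
    exact Nat.le_mul_of_pos_right _ (by omega)

lemma isUnit_iff_norm_eq_one {z : QuadraticAlgebra ℤ (-2) 1} : IsUnit z ↔ z.norm = 1 := by
  rw [QuadraticAlgebra.isUnit_iff_norm_isUnit, Int.isUnit_iff]
  have := quadNorm_nonneg z
  constructor
  · rintro (h | h) <;> omega
  · exact Or.inl

lemma quadNorm_eq_one_iff {z : QuadraticAlgebra ℤ (-2) 1} : z.norm = 1 ↔ z = 1 ∨ z = -1 := by
  refine ⟨fun h ↦ ?_, ?_⟩
  · rw [quadNorm_eq] at h
    have h1 : z.im = 0 := by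
      have h3 : z.im ^ 2 < 1 := by nlinarith [sq_nonneg (2 * z.re + z.im), sq_nonneg z.im]
      have := (sq_lt_one_iff_abs_lt_one _).1 h3
      exact Int.abs_lt_one_iff.1 this
    have h2 : z.re = 1 ∨ z.re = -1 := by
      rw [h1] at h
      exact sq_eq_one_iff.1 (by linarith)
    rcases h2 with h2 | h2
    · exact Or.inl (by ext <;> simpa)
    · exact Or.inr (by ext <;> simpa)
  · rintro (rfl | rfl) <;> simp

lemma prime_of_norm_prime {z : QuadraticAlgebra ℤ (-2) 1} {p : ℕ} (hp : p.Prime)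
    (hz : z.norm = p) : Prime z := by
  rw [← irreducible_iff_prime]
  refine ⟨fun h ↦ ?_, fun a b hab ↦ ?_⟩
  · rw [isUnit_iff_norm_eq_one, hz] at h
    exact hp.one_lt.ne' (by exact_mod_cast h)
  · rw [isUnit_iff_norm_eq_one, isUnit_iff_norm_eq_one]
    have h := congrArg QuadraticAlgebra.norm hab
    rw [hz, map_mul] at h
    have ha := quadNorm_nonneg a
    have hb := quadNorm_nonneg b
    lift a.norm to ℕ using ha with x
    lift b.norm to ℕ using hb with y
    have : p = x * y := by exact_mod_cast h
    rcases (Nat.prime_mul_iff.1 (this ▸ hp)) with ⟨_, h⟩ | ⟨_, h⟩ <;> simp [h]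

/-- A rational prime which is not a norm stays prime. -/
lemma prime_natCast {p : ℕ} (hp : p.Prime)
    (h : ∀ z : QuadraticAlgebra ℤ (-2) 1, z.norm ≠ p) :
    Prime (p : QuadraticAlgebra ℤ (-2) 1) := by
  rw [← irreducible_iff_prime]
  refine ⟨fun h ↦ ?_, fun a b hab ↦ ?_⟩
  · rw [isUnit_iff_norm_eq_one, QuadraticAlgebra.norm_natCast] at h
    have : p ^ 2 = 1 := by exact_mod_cast h
    have := hp.one_lt
    nlinarith
  · rw [isUnit_iff_norm_eq_one, isUnit_iff_norm_eq_one]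
    have h1 := congrArg QuadraticAlgebra.norm hab
    rw [QuadraticAlgebra.norm_natCast, map_mul] at h1
    have ha := quadNorm_nonneg a
    have h2 := h a
    have hb := quadNorm_nonneg b
    lift a.norm to ℕ using ha with x
    lift b.norm to ℕ using hb with y
    have h3 : x * y = p ^ 2 := by exact_mod_cast h1.symm
    obtain ⟨k, hk, hx⟩ := (Nat.dvd_prime_pow hp).1 (Dvd.intro _ h3)
    interval_cases k
    · simp [hx]
    · simp [hx] at h2
    · right
      rw [hx] at h3
      have : 0 < p ^ 2 := by have := hp.pos; positivity
      have : y = 1 := by nlinarith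
      simp [this]

/-- The elements of `ℤ[(1 + √-7) / 2]` of norm `n`. -/
def normFiber (n : ℤ) : Set (QuadraticAlgebra ℤ (-2) 1) := {z | z.norm = n}

lemma finite_normFiber (n : ℤ) : (normFiber n).Finite := by
  refine ((Set.finite_Icc (-(2 * n)) (2 * n)).prod (Set.finite_Icc (-n) n)
    |>.image fun p : ℤ × ℤ ↦ (⟨p.1, p.2⟩ : QuadraticAlgebra ℤ (-2) 1)).subset fun z hz ↦ ?_
  have hz : z.norm = n := hz
  rw [quadNorm_eq] at hz
  have h1 : |z.im| ≤ n := by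
    have h3 : |z.im| ≤ z.im ^ 2 := by rw [← sq_abs]; exact Int.le_self_sq _
    nlinarith [sq_nonneg (2 * z.re + z.im)]
  have h2 : |z.re| ≤ 2 * n := by
    have h3 : |z.re| ≤ z.re ^ 2 := by rw [← sq_abs]; exact Int.le_self_sq _
    nlinarith [sq_nonneg (z.re + 4 * z.im)]
  exact ⟨(z.re, z.im), ⟨abs_le.1 h2, abs_le.1 h1⟩, rfl⟩

lemma mul_star_eq (z : QuadraticAlgebra ℤ (-2) 1) : z * star z = (z.norm : ℤ) := by
  rw [← QuadraticAlgebra.algebraMap_norm_eq_mul_star]; rfl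

lemma dvd_star {a b : QuadraticAlgebra ℤ (-2) 1} (h : a ∣ star b) : star a ∣ b := by
  obtain ⟨c, h⟩ := h
  exact ⟨star c, by rw [← star_mul', ← h, star_star]⟩

lemma normFiber_mul_of_prime {p : ℕ} (hp : p.Prime)
    (h : ∀ z : QuadraticAlgebra ℤ (-2) 1, z.norm ≠ p) (m : ℤ) :
    (normFiber (p * m)).ncard = {w : QuadraticAlgebra ℤ (-2) 1 | p * w.norm = m}.ncard := by
  have hP := prime_natCast hp h
  have hp0 : (p : ℤ) ≠ 0 := by exact_mod_cast hp.ne_zero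
  rw [← Set.ncard_image_of_injective {w | p * w.norm = m} (mul_right_injective₀ hP.ne_zero)]
  congr 1
  ext z
  simp only [normFiber, Set.mem_ofPred_eq, Set.mem_image]
  constructor
  · intro hz
    have h1 : (p : QuadraticAlgebra ℤ (-2) 1) ∣ z * star z := by
      rw [mul_star_eq, hz]; push_cast; exact Dvd.intro _ rfl
    have h2 : (p : QuadraticAlgebra ℤ (-2) 1) ∣ z := by
      rcases hP.dvd_or_dvd h1 with h | h
      · exact h
      · simpa using dvd_star h
    obtain ⟨w, rfl⟩ := h2
    refine ⟨w, ?_, rfl⟩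
    rw [map_mul, QuadraticAlgebra.norm_natCast] at hz
    exact mul_left_cancel₀ hp0 (by rw [← hz]; ring)
  · rintro ⟨w, hw, rfl⟩
    rw [map_mul, QuadraticAlgebra.norm_natCast, ← hw]; ring

lemma normFiber_seven_mul (m : ℤ) : (normFiber (7 * m)).ncard = (normFiber m).ncard := by
  set z₀ : QuadraticAlgebra ℤ (-2) 1 := ⟨1, -2⟩
  have hn : z₀.norm = 7 := by rw [quadNorm_eq]; norm_num [z₀]
  have hs : star z₀ = -z₀ := by ext <;> simp [z₀]
  have hP : Prime z₀ := prime_of_norm_prime (p := 7) (by norm_num) hn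
  rw [← Set.ncard_image_of_injective (normFiber m) (mul_right_injective₀ hP.ne_zero)]
  congr 1
  ext z
  simp only [normFiber, Set.mem_ofPred_eq, Set.mem_image]
  constructor
  · intro hz
    have h1 : z₀ ∣ z * star z := by
      rw [mul_star_eq, hz, ← hn, Int.cast_mul, ← mul_star_eq]
      exact ⟨star z₀ * m, by ring⟩
    have h2 : z₀ ∣ z := by
      rcases hP.dvd_or_dvd h1 with h | h
      · exact h
      · simpa [hs] using dvd_star h
    obtain ⟨w, rfl⟩ := h2
    refine ⟨w, ?_, rfl⟩
    rw [map_mul, hn] at hz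
    omega
  · rintro ⟨w, hw, rfl⟩
    rw [map_mul, hn, hw]

lemma not_dvd_star {z : QuadraticAlgebra ℤ (-2) 1} {p : ℕ} (hp : p.Prime) (hp7 : p ≠ 7)
    (hz : z.norm = p) : ¬ z ∣ star z := by
  rintro ⟨u, hu⟩
  have hp0 : (p : ℤ) ≠ 0 := by exact_mod_cast hp.ne_zero
  have h1 : u.norm = 1 := by
    have := congrArg QuadraticAlgebra.norm hu
    rw [QuadraticAlgebra.norm_star, map_mul, hz] at this
    exact mul_left_cancel₀ hp0 (by rw [← this, mul_one])
  rw [quadNorm_eq] at hz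
  have hpZ : Prime (p : ℤ) := Nat.prime_iff_prime_int.1 hp
  rcases quadNorm_eq_one_iff.1 h1 with rfl | rfl
  · have h2 := congrArg QuadraticAlgebra.im hu
    simp only [mul_one, QuadraticAlgebra.im_star] at h2
    have h3 : z.im = 0 := by omega
    rw [h3] at hz
    exact hpZ.irreducible.not_isSquare ⟨z.re, by rw [← hz]; ring⟩
  · have h2 := congrArg QuadraticAlgebra.re hu
    simp only [mul_neg, mul_one, QuadraticAlgebra.re_star, QuadraticAlgebra.re_neg] at h2
    have h3 : z.im = -2 * z.re := by omega
    rw [h3] at hz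
    have h4 : (7 : ℤ) ∣ p := ⟨z.re ^ 2, by rw [← hz]; ring⟩
    have h5 : 7 ∣ p := by exact_mod_cast h4
    exact hp7 ((Nat.prime_dvd_prime_iff_eq (by norm_num) hp).1 h5).symm

lemma normFiber_mul_of_norm_eq {z : QuadraticAlgebra ℤ (-2) 1} {p : ℕ} (hp : p.Prime)
    (hp7 : p ≠ 7) (hz : z.norm = p) (m : ℤ) :
    (normFiber (p * m)).ncard + {w : QuadraticAlgebra ℤ (-2) 1 | p * w.norm = m}.ncard =
      2 * (normFiber m).ncard := by
  have hp0 : (p : ℤ) ≠ 0 := by exact_mod_cast hp.ne_zero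
  have hP : Prime z := prime_of_norm_prime hp hz
  have hz' : (star z).norm = p := by rw [QuadraticAlgebra.norm_star, hz]
  have hP' : Prime (star z) := prime_of_norm_prime hp hz'
  have hpp : z * star z = (p : QuadraticAlgebra ℤ (-2) 1) := by rw [mul_star_eq, hz]; simp
  have hP0 : (p : QuadraticAlgebra ℤ (-2) 1) ≠ 0 := by
    rw [← hpp]; exact mul_ne_zero hP.ne_zero hP'.ne_zero
  have hunion : normFiber (p * m) = (z * ·) '' normFiber m ∪ (star z * ·) '' normFiber m := by
    ext x
    simp only [normFiber, Set.mem_ofPred_eq, Set.mem_image, Set.mem_union]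
    constructor
    · intro hx
      have h1 : z ∣ x * star x := by
        rw [mul_star_eq, hx, Int.cast_mul, Int.cast_natCast, ← hpp]
        exact ⟨star z * m, by ring⟩
      rcases hP.dvd_or_dvd h1 with h | h
      · obtain ⟨w, rfl⟩ := h
        refine Or.inl ⟨w, ?_, rfl⟩
        rw [map_mul, hz] at hx
        exact mul_left_cancel₀ hp0 hx
      · obtain ⟨w, rfl⟩ := dvd_star h
        refine Or.inr ⟨w, ?_, rfl⟩
        rw [map_mul, hz'] at hx
        exact mul_left_cancel₀ hp0 hx
    · rintro (⟨w, hw, rfl⟩ | ⟨w, hw, rfl⟩)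
      · rw [map_mul, hz, hw]
      · rw [map_mul, hz', hw]
  have hinter : (z * ·) '' normFiber m ∩ (star z * ·) '' normFiber m =
      ((p : QuadraticAlgebra ℤ (-2) 1) * ·) '' {w | p * w.norm = m} := by
    ext x
    simp only [normFiber, Set.mem_ofPred_eq, Set.mem_image, Set.mem_inter_iff]
    constructor
    · rintro ⟨⟨w, hw, rfl⟩, v, hv, hwv⟩
      have h1 : z ∣ star z * v := ⟨w, hwv⟩
      obtain ⟨y, rfl⟩ := (hP.dvd_or_dvd h1).resolve_left (not_dvd_star hp hp7 hz)
      refine ⟨y, ?_, ?_⟩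
      · rw [← hv, map_mul, hz]
      · rw [← hwv, ← hpp]; ring
    · rintro ⟨w, hw, rfl⟩
      refine ⟨⟨star z * w, ?_, ?_⟩, z * w, ?_, ?_⟩
      · rw [map_mul, hz', hw]
      · rw [← hpp]; ring
      · rw [map_mul, hz, hw]
      · rw [← hpp]; ring
  have h := Set.ncard_union_add_ncard_inter ((z * ·) '' normFiber m)
    ((star z * ·) '' normFiber m) ((finite_normFiber m).image _) ((finite_normFiber m).image _)
  rw [← hunion, hinter, Set.ncard_image_of_injective _ (mul_right_injective₀ hP0),
    Set.ncard_image_of_injective _ (mul_right_injective₀ hP.ne_zero),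
    Set.ncard_image_of_injective _ (mul_right_injective₀ hP'.ne_zero)] at h
  rw [h, two_mul]

lemma chi_of_norm_eq {z : QuadraticAlgebra ℤ (-2) 1} {p : ℕ} (hp : p.Prime) (hp7 : p ≠ 7)
    (hz : z.norm = p) : chi p = 1 := by
  have key : ∀ a s : ZMod 7, 4 * a = s ^ 2 → a ≠ 0 → chi a = 1 := by decide
  have h7 : (7 : ZMod 7) = 0 := rfl
  rw [quadNorm_eq] at hz
  refine key p (2 * z.re + z.im) ?_ fun h ↦ hp7 ?_
  · have h1 := congrArg (Int.cast : ℤ → ZMod 7) hz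
    push_cast at h1
    rw [← h1]
    linear_combination (z.im : ZMod 7) ^ 2 * h7
  · rw [ZMod.natCast_eq_zero_iff] at h
    exact ((Nat.prime_dvd_prime_iff_eq (by norm_num) hp).1 h).symm

lemma not_prime_natCast_of_dvd {p : ℕ} (hp : p.Prime) {t : ℤ} (ht : (p : ℤ) ∣ t ^ 2 + t + 2) :
    ¬ Prime (p : QuadraticAlgebra ℤ (-2) 1) := by
  intro hP
  have h1 : (p : QuadraticAlgebra ℤ (-2) 1) ∣ ⟨t, 1⟩ * star ⟨t, 1⟩ := by
    rw [mul_star_eq, quadNorm_eq]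
    obtain ⟨c, hc⟩ := ht
    refine ⟨(c : ℤ), ?_⟩
    simp only [mul_one, one_pow, hc]
    push_cast; rfl
  have h2 : (p : QuadraticAlgebra ℤ (-2) 1) ∣ ⟨t, 1⟩ := by
    rcases hP.dvd_or_dvd h1 with h | h
    · exact h
    · simpa using dvd_star h
  obtain ⟨w, hw⟩ := h2
  have h3 := congrArg QuadraticAlgebra.im hw
  simp at h3
  have h4 : (p : ℤ) ∣ 1 := ⟨w.im, h3⟩
  exact hp.one_lt.ne' (Nat.dvd_one.1 (by exact_mod_cast h4))

lemma chi_of_forall_norm_ne {p : ℕ} (hp : p.Prime)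
    (h : ∀ z : QuadraticAlgebra ℤ (-2) 1, z.norm ≠ p) : chi p = -1 := by
  have key : ∀ a : ZMod 7, a ≠ 0 → ¬ IsSquare a → chi a = -1 := by decide
  have hp7 : p ≠ 7 := by
    rintro rfl
    exact h ⟨1, -2⟩ (by rw [quadNorm_eq]; norm_num)
  have hp2 : p ≠ 2 := by
    rintro rfl
    exact h ⟨0, 1⟩ (by rw [quadNorm_eq]; norm_num)
  have : Fact p.Prime := ⟨hp⟩
  have : Fact (Nat.Prime 7) := ⟨by norm_num⟩
  refine key p (fun h0 ↦ hp7 ?_) fun hsq ↦ ?_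
  · rw [ZMod.natCast_eq_zero_iff] at h0
    exact ((Nat.prime_dvd_prime_iff_eq (by norm_num) hp).1 h0).symm
  rw [FiniteField.isSquare_odd_prime_iff (by rw [ZMod.ringChar_zmod_n]; norm_num) hp2,
    ZMod.card, Ne, quadraticChar_neg_one_iff_not_isSquare, not_not] at hsq
  have h4 : ZMod.χ₄ ((7 : ℕ) : ZMod 4) = -1 := by decide
  rw [h4] at hsq
  obtain ⟨s, hs⟩ := hsq
  have h20 : (2 : ZMod p) ≠ 0 := fun h2 ↦ hp2 <| by
    have : ((2 : ℕ) : ZMod p) = 0 := by exact_mod_cast h2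
    rw [ZMod.natCast_eq_zero_iff] at this
    exact (Nat.prime_dvd_prime_iff_eq hp (by norm_num)).1 this
  obtain ⟨t, ht⟩ := ZMod.intCast_surjective ((s - 1) / 2)
  refine not_prime_natCast_of_dvd hp (t := t) ?_ (prime_natCast hp h)
  rw [← ZMod.intCast_zmod_eq_zero_iff_dvd]
  push_cast at hs ⊢
  rw [ht]
  field_simp
  linear_combination -hs

lemma chi_mul (a b : ZMod 7) : chi (a * b) = chi a * chi b := by
  revert a b; decide

lemma chiSum_prime_mul {p : ℕ} (hp : p.Prime) {m : ℕ} (hm : m ≠ 0) :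
    chiSum (p * m) + (if p ∣ m then chi p * chiSum (m / p) else 0) =
      chiSum m + chi p * chiSum m := by
  have hinj : Function.Injective (p * ·) := mul_right_injective₀ hp.ne_zero
  have himg : ∀ k : ℕ, ∑ d ∈ k.divisors.image (p * ·), chi (d : ℕ) = chi p * chiSum k := fun k ↦ by
    rw [Finset.sum_image hinj.injOn, chiSum, Finset.mul_sum]
    simp only [Nat.cast_mul, chi_mul]
  have hu : (p * m).divisors = m.divisors ∪ m.divisors.image (p * ·) := by
    ext d
    simp only [Nat.mem_divisors, Finset.mem_union, Finset.mem_image, mul_ne_zero hp.ne_zero hm,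
      ne_eq, not_false_eq_true, and_true, hm]
    constructor
    · intro hd
      by_cases hpd : p ∣ d
      · obtain ⟨e, rfl⟩ := hpd
        exact Or.inr ⟨e, (Nat.mul_dvd_mul_iff_left hp.pos).1 hd, rfl⟩
      · exact Or.inl (((Nat.Prime.coprime_iff_not_dvd hp).2 hpd).symm.dvd_of_dvd_mul_left hd)
    · rintro (hd | ⟨e, he, rfl⟩)
      · exact hd.mul_left p
      · exact mul_dvd_mul_left p he
  have hi : ∑ d ∈ m.divisors ∩ m.divisors.image (p * ·), chi d =
      if p ∣ m then chi p * chiSum (m / p) else 0 := by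
    split_ifs with hpm
    · rw [← himg]
      congr 1
      obtain ⟨k, rfl⟩ := hpm
      have hk : k ≠ 0 := right_ne_zero_of_mul hm
      rw [Nat.mul_div_cancel_left _ hp.pos]
      ext d
      simp only [Nat.mem_divisors, Finset.mem_inter, Finset.mem_image, hm, ne_eq,
        not_false_eq_true, and_true, hk]
      constructor
      · rintro ⟨h1, e, h2, rfl⟩
        exact ⟨e, (Nat.mul_dvd_mul_iff_left hp.pos).1 h1, rfl⟩
      · rintro ⟨e, he, rfl⟩
        exact ⟨mul_dvd_mul_left p he, e, he.mul_left p, rfl⟩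
    · refine Finset.sum_eq_zero fun d hd ↦ absurd ?_ hpm
      simp only [Nat.mem_divisors, Finset.mem_inter, Finset.mem_image] at hd
      obtain ⟨⟨h1, -⟩, e, -, rfl⟩ := hd
      exact (Dvd.intro _ rfl).trans h1
  rw [← hi, chiSum, hu, Finset.sum_union_inter, himg]; rfl

/-- The number of elements of norm `n` is `2 ∑_{d ∣ n} χ(d)`. -/
theorem ncard_normFiber (n : ℕ) (hn : n ≠ 0) : ((normFiber n).ncard : ℤ) = 2 * chiSum n := by
  induction n using Nat.strong_induction_on with
  | _ n ih =>
  rcases eq_or_ne n 1 with rfl | h1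
  · have : normFiber (1 : ℕ) = {1, -1} := by
      ext z
      simpa [normFiber] using quadNorm_eq_one_iff
    have hne : (1 : QuadraticAlgebra ℤ (-2) 1) ≠ -1 := fun h ↦ by
      have := congrArg QuadraticAlgebra.re h
      rw [QuadraticAlgebra.re_neg, QuadraticAlgebra.re_one] at this
      norm_num at this
    rw [this, Set.ncard_pair hne]
    decide
  obtain ⟨p, hp, m, rfl⟩ := Nat.exists_prime_and_dvd h1
  have hm : m ≠ 0 := right_ne_zero_of_mul hn
  have hmlt : m < p * m := lt_mul_of_one_lt_left (Nat.pos_of_ne_zero hm) hp.one_lt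
  have ihm := ih m hmlt hm
  have hquot : ({w : QuadraticAlgebra ℤ (-2) 1 | p * w.norm = (m : ℤ)}.ncard : ℤ) =
      2 * if p ∣ m then chiSum (m / p) else 0 := by
    split_ifs with hpm
    · obtain ⟨k, rfl⟩ := hpm
      have hk : k ≠ 0 := right_ne_zero_of_mul hm
      rw [Nat.mul_div_cancel_left _ hp.pos, ← ih k _ hk]
      · congr 2
        ext w
        simp [normFiber, hp.ne_zero]
      · exact lt_of_le_of_lt (Nat.le_mul_of_pos_left k hp.pos) hmlt
    · have : {w : QuadraticAlgebra ℤ (-2) 1 | p * w.norm = (m : ℤ)} = ∅ := by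
        refine Set.eq_empty_of_forall_notMem fun w hw ↦ hpm ?_
        have : (p : ℤ) ∣ m := ⟨w.norm, Eq.symm hw⟩
        exact_mod_cast this
      simp [this]
  have hrec := chiSum_prime_mul hp hm
  rw [Nat.cast_mul]
  by_cases h : ∃ z : QuadraticAlgebra ℤ (-2) 1, z.norm = p
  · obtain ⟨z, hz⟩ := h
    rcases eq_or_ne p 7 with rfl | hp7
    · have h7 : chi ((7 : ℕ) : ZMod 7) = 0 := by decide
      rw [h7] at hrec
      simp only [zero_mul, ite_self, add_zero] at hrec
      rw [hrec, ← ihm]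
      exact_mod_cast normFiber_seven_mul m
    · have h3 := normFiber_mul_of_norm_eq hp hp7 hz m
      zify at h3
      rw [chi_of_norm_eq hp hp7 hz] at hrec
      simp only [one_mul] at hrec
      rw [hquot, ihm] at h3
      linarith
  · push Not at h
    rw [normFiber_mul_of_prime hp h, hquot]
    rw [chi_of_forall_norm_ne hp h] at hrec
    split_ifs at hrec ⊢ <;> linarith

end NormForm

section Lambert

lemma summable_lambert {q : ℂ} (hq : ‖q‖ < 1) :
    Summable fun n : ℕ ↦ (n : ℂ) * q ^ n / (1 - q ^ n) := by
  simpa using summable_norm_pow_mul_geometric_div_one_sub 1 hq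

/-- The Lambert series `∑_{j ≥ 1} j q ^ j / (1 - q ^ j)`. -/
def lambert (q : ℂ) : ℂ := ∑' j : ℕ, ((j : ℂ) + 1) * q ^ (j + 1) / (1 - q ^ (j + 1))

lemma summable_lambert_succ {q : ℂ} (hq : ‖q‖ < 1) :
    Summable fun j : ℕ ↦ ((j : ℂ) + 1) * q ^ (j + 1) / (1 - q ^ (j + 1)) := by
  simpa using (summable_nat_add_iff 1).2 (summable_lambert hq)

lemma hasSum_lambert {q : ℂ} (hq : ‖q‖ < 1) {a : ℕ → ℂ} (ha : ∀ n, ‖a n‖ ≤ n) :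
    HasSum (fun n : ℕ ↦ (∑ d ∈ n.divisors, a d) * q ^ n)
      (∑' j : ℕ, a (j + 1) * (q ^ (j + 1) / (1 - q ^ (j + 1)))) := by
  set F : ℕ × ℕ → ℂ := fun p ↦ a (p.1 + 1) * q ^ ((p.1 + 1) * (p.2 + 1)) with hF
  have hr : ‖‖q‖‖ < 1 := by rwa [norm_norm]
  have hS : Summable F := by
    have h1 : Summable fun d : ℕ ↦ ((d : ℝ) + 1) * ‖q‖ ^ d := by
      simpa [add_mul] using (summable_pow_mul_geometric_of_norm_lt_one 1 hr).add
        (summable_geometric_of_norm_lt_one hr)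
    have h2 := h1.mul_of_nonneg (summable_geometric_of_norm_lt_one hr)
      (fun d ↦ by positivity) (fun k ↦ by positivity)
    refine Summable.of_norm_bounded h2 fun p ↦ ?_
    rw [hF, norm_mul, norm_pow, mul_assoc, ← pow_add]
    refine mul_le_mul (by simpa using ha (p.1 + 1))
      (pow_le_pow_of_le_one (norm_nonneg _) hq.le (by nlinarith)) (by positivity) (by positivity)
  have hsum : ∑' p, F p = ∑' j : ℕ, a (j + 1) * (q ^ (j + 1) / (1 - q ^ (j + 1))) := by
    rw [hS.tsum_prod]
    refine tsum_congr fun d ↦ ?_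
    have hd : ‖q ^ (d + 1)‖ < 1 := norm_pow_lt_one hq d.succ_ne_zero
    rw [div_eq_mul_inv, ← tsum_geometric_of_norm_lt_one hd, ← tsum_mul_left, ← tsum_mul_left]
    refine tsum_congr fun k ↦ ?_
    simp only [hF]
    rw [pow_mul, pow_succ' (q ^ (d + 1)) k]
  rw [← hsum]
  have h := hS.hasSum.tsum_fiberwise fun p : ℕ × ℕ ↦ (p.1 + 1) * (p.2 + 1)
  refine (congrArg (HasSum · (∑' p, F p)) (funext fun n ↦ ?_)).mpr h
  have hset : (fun p : ℕ × ℕ ↦ (p.1 + 1) * (p.2 + 1)) ⁻¹' {n} =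
      ↑(n.divisorsAntidiagonal.image fun p ↦ (p.1 - 1, p.2 - 1)) := by
    ext ⟨d, k⟩
    simp only [Set.mem_preimage, Set.mem_singleton_iff, Finset.coe_image, Set.mem_image,
      Finset.mem_coe, Nat.mem_divisorsAntidiagonal, Prod.mk.injEq, Prod.exists]
    constructor
    · rintro rfl
      exact ⟨d + 1, k + 1, ⟨rfl, by positivity⟩, rfl, rfl⟩
    · rintro ⟨x, y, ⟨rfl, h⟩, rfl, rfl⟩
      rw [mul_ne_zero_iff] at h
      rw [Nat.sub_add_cancel (Nat.pos_of_ne_zero h.1), Nat.sub_add_cancel (Nat.pos_of_ne_zero h.2)]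
  rw [hset, Finset.tsum_subtype', Finset.sum_image, Finset.sum_mul,
    ← Nat.sum_divisorsAntidiagonal fun d _ ↦ a d * q ^ n]
  · refine Finset.sum_congr rfl fun p hp ↦ ?_
    obtain ⟨rfl, h⟩ := Nat.mem_divisorsAntidiagonal.1 hp
    rw [mul_ne_zero_iff] at h
    simp only [hF]
    rw [Nat.sub_add_cancel (Nat.pos_of_ne_zero h.1), Nat.sub_add_cancel (Nat.pos_of_ne_zero h.2)]
  · rintro ⟨x, y⟩ hp ⟨x', y'⟩ hp' h
    have h1 := (Nat.mem_divisorsAntidiagonal.1 hp)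
    have h2 := (Nat.mem_divisorsAntidiagonal.1 hp')
    have h3 := mul_ne_zero_iff.1 (h1.1 ▸ h1.2)
    have h4 := mul_ne_zero_iff.1 (h2.1 ▸ h2.2)
    simp only [Prod.mk.injEq] at h h3 h4 ⊢
    omega

lemma hasSum_sigmaSeven {q : ℂ} (hq : ‖q‖ < 1) :
    HasSum (fun n ↦ (sigmaSeven n : ℂ) * q ^ n) (lambert q - 7 * lambert (q ^ 7)) := by
  set f : ℕ → ℂ := fun n ↦ (n : ℂ) * q ^ n / (1 - q ^ n) with hf
  have hq7 : ‖q ^ 7‖ < 1 := norm_pow_lt_one hq (by norm_num)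
  have hfs : Summable f := summable_lambert hq
  have h1 := hasSum_lambert hq (a := fun d ↦ if (d : ZMod 7) = 0 then 0 else (d : ℂ))
    (fun n ↦ by split_ifs <;> simp)
  set g : ℕ → ℂ := fun n ↦ if (n : ZMod 7) = 0 then f n else 0 with hg
  have hinj : Function.Injective fun m : ℕ ↦ 7 * m := fun _ _ h ↦ by simpa using h
  have hgs : Summable g := by
    refine (hfs.indicator {n : ℕ | (n : ZMod 7) = 0}).congr fun n ↦ ?_
    simp [hg, Set.indicator_apply]
  have hg7 : ∀ m, g (7 * m) = 7 * (m * (q ^ 7) ^ m / (1 - (q ^ 7) ^ m)) := fun m ↦ by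
    have h7 : (7 : ZMod 7) = 0 := rfl
    simp only [hg, hf, Nat.cast_mul, Nat.cast_ofNat, h7, zero_mul, if_true, pow_mul]
    ring
  have hgt : ∑' n, g n = 7 * lambert (q ^ 7) := by
    rw [← hinj.tsum_eq (f := g)]
    · simp only [hg7]
      rw [tsum_mul_left, (summable_lambert hq7).tsum_eq_zero_add]
      simp [lambert]
    · intro n hn
      have : (n : ZMod 7) = 0 := by
        by_contra h
        simp [hg, h] at hn
      rw [ZMod.natCast_eq_zero_iff] at this
      obtain ⟨m, rfl⟩ := this
      exact ⟨m, rfl⟩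
  have hft : ∑' n, f n = lambert q := by
    rw [hfs.tsum_eq_zero_add]
    simp [hf, lambert]
  rw [← hgt, ← hft, ← hfs.tsum_sub hgs, (hfs.sub hgs).tsum_eq_zero_add]
  convert h1 using 1
  · ext n
    simp only [sigmaSeven]
    push_cast
    rfl
  · have h0 : f 0 - g 0 = 0 := by simp [hg, hf]
    rw [h0, zero_add]
    refine tsum_congr fun j ↦ ?_
    simp only [hg, hf]
    split_ifs <;> ring

end Lambert

section Theta

lemma ncard_normForm (n : ℕ) :
    Nat.card ((fun p : ℤ × ℤ ↦ (normForm p).toNat) ⁻¹' {n}) = (normFiber n).ncard := by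
  have hinj : Function.Injective fun p : ℤ × ℤ ↦ (⟨p.1, p.2⟩ : QuadraticAlgebra ℤ (-2) 1) := by
    rintro ⟨a, b⟩ ⟨c, d⟩ h
    simpa using h
  rw [Nat.card_coe_set_eq, ← Set.ncard_image_of_injective _ hinj]
  congr 1
  ext z
  simp only [Set.mem_image, Set.mem_preimage, Set.mem_singleton_iff, normFiber,
    Set.mem_ofPred_eq]
  constructor
  · rintro ⟨p, h, rfl⟩
    have := normForm_nonneg p
    rw [quadNorm_eq]
    change normForm p = n
    omega
  · intro h
    refine ⟨(z.re, z.im), ?_, rfl⟩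
    rw [quadNorm_eq] at h
    change normForm (z.re, z.im) = n at h
    omega

lemma hasSum_theta {q : ℂ} (hq : ‖q‖ < 1) :
    HasSum (fun n ↦ 2 * ((chiSum n : ℂ) * q ^ n)) (theta q - 1) := by
  have h := (summable_norm_theta hq).of_norm.hasSum.tsum_fiberwise
    fun p : ℤ × ℤ ↦ (normForm p).toNat
  have h0 : HasSum (fun n : ℕ ↦ if n = 0 then (1 : ℂ) else 0) 1 := hasSum_ite_eq 0 1
  refine (congrArg (HasSum · (theta q - 1)) (funext fun n ↦ ?_)).mpr (h.sub h0)
  have h1 : ∀ b : (fun p : ℤ × ℤ ↦ (normForm p).toNat) ⁻¹' {n},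
      q ^ (normForm b).toNat = q ^ n := fun b ↦ congrArg (q ^ ·) b.2
  rw [tsum_congr h1, tsum_const, ncard_normForm, nsmul_eq_mul]
  split_ifs with hn
  · subst hn
    have h2 : normFiber ((0 : ℕ) : ℤ) = {0} := by
      ext z
      simpa [normFiber] using quadNorm_eq_zero
    rw [h2, Set.ncard_singleton]
    simp [chiSum]
  · have h3 := congrArg (Int.cast : ℤ → ℂ) (ncard_normFiber n hn)
    push_cast at h3
    rw [h3, sub_zero, mul_assoc]

lemma theta_sq {q : ℂ} (hq : ‖q‖ < 1) :
    theta q ^ 2 = 1 + 4 * (lambert q - 7 * lambert (q ^ 7)) := by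
  set c : ℕ → ℂ := fun n ↦ (chiSum n : ℂ) * q ^ n with hc
  have hs : Summable c := by
    exact (summable_mul_left_iff two_ne_zero).1 (hasSum_theta hq).summable
  have ht : theta q = 1 + 2 * ∑' n, c n := by
    rw [← tsum_mul_left, (hasSum_theta hq).tsum_eq]; ring
  have hcc : ∀ n, ∑ p ∈ Finset.HasAntidiagonal.antidiagonal n, c p.1 * c p.2 =
      (sigmaSeven n : ℂ) * q ^ n - c n := fun n ↦ by
    have h1 := congrArg (Int.cast : ℤ → ℂ) ((sum_antidiagonal_chiSum n).trans (sum_quads_chi n))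
    push_cast at h1
    simp only [hc]
    rw [← sub_mul, ← h1, Finset.sum_mul]
    refine Finset.sum_congr rfl fun p hp ↦ ?_
    rw [← Finset.HasAntidiagonal.mem_antidiagonal.1 hp, pow_add]
    ring
  have hsq : (∑' n, c n) * ∑' n, c n = (lambert q - 7 * lambert (q ^ 7)) - ∑' n, c n := by
    rw [tsum_mul_tsum_eq_tsum_sum_antidiagonal_of_summable_norm hs.norm hs.norm]
    simp only [hcc]
    rw [(hasSum_sigmaSeven hq).summable.tsum_sub hs, (hasSum_sigmaSeven hq).tsum_eq]
  rw [ht]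
  linear_combination 4 * hsq

lemma tsum_phi {q : ℂ} (hq : ‖q‖ < 1) :
    1 + 2 * ∑' k : ℕ, (-1) ^ (k + 1) * q ^ ((k + 1) ^ 2) =
      (∏' n : ℕ, (1 - q ^ (n + 1))) ^ 2 / ∏' n : ℕ, (1 - (q ^ 2) ^ (n + 1)) :=
  tendsto_nhds_unique
    (((summable_phi hq).of_norm.hasSum.tendsto_sum_nat.const_mul 2).const_add 1) (gauss_phi hq)

lemma tsum_psi {q : ℂ} (hq : ‖q‖ < 1) :
    ∑' k : ℕ, q ^ (k * (k + 1) / 2) =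
      (∏' n : ℕ, (1 - (q ^ 2) ^ (n + 1))) ^ 2 / ∏' n : ℕ, (1 - q ^ (n + 1)) :=
  tendsto_nhds_unique ((summable_psi hq).of_norm.hasSum.tendsto_sum_nat.comp
    (tendsto_atTop_mono (fun n ↦ by change n ≤ _; lia) tendsto_id)) (gauss_psi hq)

lemma phi_mul_psi {q : ℂ} (hq : ‖q‖ < 1) :
    (1 + 2 * ∑' k : ℕ, (-1) ^ (k + 1) * q ^ ((k + 1) ^ 2)) * ∑' k : ℕ, q ^ (k * (k + 1) / 2) =
      (∏' n : ℕ, (1 - q ^ (n + 1))) * ∏' n : ℕ, (1 - (q ^ 2) ^ (n + 1)) := by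
  have h1 := tprod_one_sub_pow_ne_zero hq
  have h2 := tprod_one_sub_pow_ne_zero (norm_pow_lt_one hq two_ne_zero)
  rw [tsum_phi hq, tsum_psi hq]
  field_simp

lemma tprod_eta {q : ℂ} (hq : ‖q‖ < 1) :
    ∏' n : ℕ, ((1 - q ^ (1 * (n + 1))) * (1 - q ^ (2 * (n + 1))) * (1 - q ^ (7 * (n + 1))) *
      (1 - q ^ (14 * (n + 1)))) =
    ((∏' n : ℕ, (1 - q ^ (n + 1))) * ∏' n : ℕ, (1 - (q ^ 2) ^ (n + 1))) *
      ((∏' n : ℕ, (1 - (q ^ 7) ^ (n + 1))) * ∏' n : ℕ, (1 - ((q ^ 7) ^ 2) ^ (n + 1))) := by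
  have h7 := norm_pow_lt_one hq (n := 7) (by norm_num)
  have m1 := ModularForm.multipliable_one_sub_pow hq
  have m2 := ModularForm.multipliable_one_sub_pow (norm_pow_lt_one hq two_ne_zero)
  have m7 := ModularForm.multipliable_one_sub_pow h7
  have m14 := ModularForm.multipliable_one_sub_pow (norm_pow_lt_one h7 two_ne_zero)
  rw [← m1.tprod_mul m2, ← m7.tprod_mul m14, ← (m1.mul m2).tprod_mul (m7.mul m14)]
  refine tprod_congr fun n ↦ ?_
  rw [← pow_mul, ← pow_mul, ← pow_mul, ← pow_mul, one_mul]
  ring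

lemma tsum_lambert {q : ℂ} (hq : ‖q‖ < 1) :
    ∑' j : ℕ,
        (((j : ℂ) + 1) * q ^ (1 * (j + 1)) / (1 - q ^ (1 * (j + 1))) -
          ((j : ℂ) + 1) * q ^ (2 * (j + 1)) / (1 - q ^ (2 * (j + 1))) -
          7 * ((j : ℂ) + 1) * q ^ (7 * (j + 1)) / (1 - q ^ (7 * (j + 1))) +
          7 * ((j : ℂ) + 1) * q ^ (14 * (j + 1)) / (1 - q ^ (14 * (j + 1)))) =
      lambert q - lambert (q ^ 2) - 7 * lambert (q ^ 7) + 7 * lambert ((q ^ 2) ^ 7) := by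
  have h2 := norm_pow_lt_one hq two_ne_zero
  have s1 := summable_lambert_succ hq
  have s2 := summable_lambert_succ h2
  have s7 := (summable_lambert_succ (norm_pow_lt_one hq (n := 7) (by norm_num))).mul_left 7
  have s14 := (summable_lambert_succ (norm_pow_lt_one h2 (n := 7) (by norm_num))).mul_left 7
  simp only [lambert]
  rw [← tsum_mul_left, ← tsum_mul_left, ← s1.tsum_sub s2, ← (s1.sub s2).tsum_sub s7,
    ← ((s1.sub s2).sub s7).tsum_add s14]
  refine tsum_congr fun j ↦ ?_
  have h14 : (q ^ 2) ^ 7 = q ^ 14 := by rw [← pow_mul]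
  simp only [h14, ← pow_mul, one_mul, mul_div_assoc, mul_assoc]

end Theta

end Auxiliary

theorem statement16 (q : ℂ) (hq : ‖q‖ < 1) :
    q ^ 2 * (∑' n : ℕ, (q) ^ (n * (n + 1) / 2)) ^ 2 * (∑' n : ℕ, (q ^ 7) ^ (n * (n + 1) / 2)) ^ 2 =
      (1 / 3) * ∑' j : ℕ,
        (((j : ℂ) + 1) * q ^ (1 * (j + 1)) / (1 - q ^ (1 * (j + 1))) - ((j : ℂ) + 1) * q ^ (2 * (j + 1)) / (1 - q ^ (2 * (j + 1))) - 7 * ((j : ℂ) + 1) * q ^ (7 * (j + 1)) / (1 - q ^ (7 * (j + 1))) + 7 * ((j : ℂ) + 1) * q ^ (14 * (j + 1)) / (1 - q ^ (14 * (j + 1))))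
        - (1 / 3) * (q * ∏' n : ℕ, ((1 - q ^ (1 * (n + 1))) * (1 - q ^ (2 * (n + 1))) * (1 - q ^ (7 * (n + 1))) * (1 - q ^ (14 * (n + 1))))) := by
  have h7 := norm_pow_lt_one hq (n := 7) (by norm_num)
  have e1 := theta_sq hq
  have e2 := theta_sq (norm_pow_lt_one hq two_ne_zero)
  have e3 := theta_eq_add hq
  have e4 := thetaOdd_eq_psi hq
  have e5 := phi_mul_phi hq
  have e6 := phi_mul_psi hq
  have e7 := phi_mul_psi h7
  rw [tsum_lambert hq, tprod_eta hq, ← e6, ← e7]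
  rw [e3] at e1
  rw [e4] at e1 e5
  set ψ := ∑' n : ℕ, q ^ (n * (n + 1) / 2)
  set ψ' := ∑' n : ℕ, (q ^ 7) ^ (n * (n + 1) / 2)
  linear_combination (1 / 12) * e1 - (1 / 12) * e2 + (1 / 3) * q * ψ * ψ' * e5
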